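/- For all fixed k and d there is a constant C (depending only on k and d) such that: for every inverse temperature β > 0 and every k-local Hamiltonian H = ∑_{e∈E} h_e on n qudits of local dimension d with m interactions each of operator norm ‖h_e‖_∞ ≤ 1, there exists a product mixed state σ_β = ⊗_{u=1}^n σ_u (each σ_u a d×d density matrix) such that F(β) ≤ Tr[H σ_β] − S(σ_β)/β ≤ F(β) + C·n^{(k−1)/3}·m^{2/3}. -/

import Mathlib

open scoped BigOperators ComplexOrder

noncomputable section

namespace QLH

/-- The operator (spectral) norm of a square complex matrix. -/
def opNorm {m : Type*} [Fintype m] [DecidableEq m] (A : Matrix m m ℂ) : ℝ :=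
  ‖Matrix.toEuclideanCLM (𝕜 := ℂ) A‖

/-- A density matrix: positive semidefinite with unit trace. -/
def IsDensity {m : Type*} [Fintype m] (ρ : Matrix m m ℂ) : Prop :=
  ρ.PosSemidef ∧ ρ.trace = 1

/-- The (real) energy `Tr[Hρ]`. -/
def energy {m : Type*} [Fintype m] (H ρ : Matrix m m ℂ) : ℝ :=
  ((H * ρ).trace).re

/-- Von Neumann entropy via eigenvalues. -/
def entropy {m : Type*} [Fintype m] [DecidableEq m] (ρ : Matrix m m ℂ) : ℝ :=
  if h : ρ.IsHermitian then -∑ i, h.eigenvalues i * Real.log (h.eigenvalues i) else 0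

/-- The free-energy functional at inverse temperature `β`. -/
def freeEnergyFun {m : Type*} [Fintype m] [DecidableEq m] (β : ℝ) (H ρ : Matrix m m ℂ) : ℝ :=
  energy H ρ - entropy ρ / β

/-- The free energy: the infimum of the free-energy functional over density matrices. -/
def freeEnergy {m : Type*} [Fintype m] [DecidableEq m] (β : ℝ) (H : Matrix m m ℂ) : ℝ :=
  sInf {x : ℝ | ∃ ρ, IsDensity ρ ∧ x = freeEnergyFun β H ρ}

/-- `A` acts (nontrivially) only on the sites in `e`. -/
def ActsOn {n : ℕ} {α : Type*} [Fintype α] [DecidableEq α]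
    (A : Matrix (Fin n → α) (Fin n → α) ℂ) (e : Finset (Fin n)) : Prop :=
  ∃ M : Matrix ({u // u ∈ e} → α) ({u // u ∈ e} → α) ℂ,
    ∀ x y, A x y =
      (if ∀ u ∉ e, x u = y u then (1 : ℂ) else 0) *
        M (fun u => x u.1) (fun u => y u.1)

/-- Tensor-product (product) state built from single-site matrices. -/
def prodState {n : ℕ} {α : Type*} [Fintype α] (σ : Fin n → Matrix α α ℂ) :
    Matrix (Fin n → α) (Fin n → α) ℂ :=
  fun x y => ∏ u, σ u (x u) (y u)

/-- A separable state: a finite convex combination of product states. -/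
def IsSeparable {n : ℕ} {α : Type*} [Fintype α] [DecidableEq α]
    (σ : Matrix (Fin n → α) (Fin n → α) ℂ) : Prop :=
  ∃ (N : ℕ) (p : Fin N → ℝ) (τ : Fin N → Fin n → Matrix α α ℂ),
    (∀ i, 0 ≤ p i) ∧ (∑ i, p i = 1) ∧ (∀ i u, IsDensity (τ i u)) ∧
    σ = ∑ i, (p i : ℂ) • prodState (τ i)

set_option linter.unusedSectionVars false

/-! ### Classical conditional expectations on a finite product space -/

section Classical

variable {n : ℕ} {A : Type} [Fintype A] [DecidableEq A]

/-- `x` and `y` agree on `S`. -/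
def Agree (S : Finset (Fin n)) (x y : Fin n → A) : Prop := ∀ u ∈ S, x u = y u

instance (S : Finset (Fin n)) (x y : Fin n → A) : Decidable (Agree S x y) := by
  unfold Agree; infer_instance

lemma Agree.symm {S : Finset (Fin n)} {x y : Fin n → A} (h : Agree S x y) : Agree S y x :=
  fun u hu => (h u hu).symm

lemma Agree.trans {S : Finset (Fin n)} {x y z : Fin n → A} (h : Agree S x y) (h' : Agree S y z) :
    Agree S x z := fun u hu => (h u hu).trans (h' u hu)

lemma agree_comm {S : Finset (Fin n)} {x y : Fin n → A} : Agree S x y ↔ Agree S y x :=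
  ⟨Agree.symm, Agree.symm⟩

/-- `f` depends only on the coordinates in `S`. -/
def Dep {β : Type*} (S : Finset (Fin n)) (f : (Fin n → A) → β) : Prop :=
  ∀ x y, Agree S x y → f x = f y

lemma Dep.mono {β : Type*} {S T : Finset (Fin n)} {f : (Fin n → A) → β} (h : Dep S f)
    (hST : S ⊆ T) : Dep T f := fun x y hxy => h x y (fun u hu => hxy u (hST hu))

/-- marginal weight -/
def mg (P : (Fin n → A) → ℝ) (S : Finset (Fin n)) (x : Fin n → A) : ℝ :=
  ∑ y, if Agree S x y then P y else 0

/-- conditional expectation -/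
def ce (P : (Fin n → A) → ℝ) (S : Finset (Fin n)) (f : (Fin n → A) → ℂ) (x : Fin n → A) : ℂ :=
  (∑ y, if Agree S x y then (P y : ℂ) * f y else 0) / (mg P S x : ℂ)

lemma agree_congr {S : Finset (Fin n)} {x y : Fin n → A} (h : Agree S x y) (z : Fin n → A) :
    Agree S x z ↔ Agree S y z := ⟨fun h' => h.symm.trans h', fun h' => h.trans h'⟩

lemma mg_dep (P : (Fin n → A) → ℝ) (S : Finset (Fin n)) : Dep S (mg P S) := by
  intro x y h
  unfold mg
  simp only [agree_congr h]

lemma ce_dep (P : (Fin n → A) → ℝ) (S : Finset (Fin n)) (f : (Fin n → A) → ℂ) :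
    Dep S (ce P S f) := by
  intro x y h
  unfold ce
  simp only [agree_congr h, mg_dep P S x y h]

lemma le_mg {P : (Fin n → A) → ℝ} (hP : ∀ x, 0 ≤ P x) (S : Finset (Fin n)) (x : Fin n → A) :
    P x ≤ mg P S x := by
  unfold mg
  have := Finset.single_le_sum (f := fun y => if Agree S x y then P y else 0)
    (fun y _ => by split_ifs <;> simp [hP]) (Finset.mem_univ x)
  simpa [Agree] using this

lemma mg_nonneg {P : (Fin n → A) → ℝ} (hP : ∀ x, 0 ≤ P x) (S : Finset (Fin n)) (x : Fin n → A) :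
    0 ≤ mg P S x := (hP x).trans (le_mg hP S x)

lemma sum_ce_mul {P : (Fin n → A) → ℝ} (hP : ∀ x, 0 ≤ P x) (S : Finset (Fin n))
    (f g : (Fin n → A) → ℂ) (hg : Dep S g) :
    ∑ x, (P x : ℂ) * (ce P S f x * g x) = ∑ x, (P x : ℂ) * (f x * g x) := by
  have h1 : ∀ x, (P x : ℂ) * (ce P S f x * g x) =
      ∑ y, if Agree S x y then (P y : ℂ) * f y * g y / (mg P S y : ℂ) * P x else 0 := by
    intro x
    unfold ce
    rw [div_mul_eq_mul_div, Finset.sum_mul, Finset.sum_div, Finset.mul_sum]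
    refine Finset.sum_congr rfl fun y _ => ?_
    split_ifs with h
    · rw [hg x y h, mg_dep P S x y h]; ring
    · simp
  simp_rw [h1]
  rw [Finset.sum_comm]
  refine Finset.sum_congr rfl fun y _ => ?_
  have h2 : ∀ x, (if Agree S x y then (P y : ℂ) * f y * g y / (mg P S y : ℂ) * P x else 0) =
      (P y : ℂ) * f y * g y / (mg P S y : ℂ) * (if Agree S y x then P x else 0 : ℝ) := by
    intro x
    by_cases h : Agree S x y
    · simp [h, h.symm]
    · have h' : ¬ Agree S y x := fun h'' => h h''.symm
      simp [h, h']
  simp_rw [h2]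
  rw [← Finset.mul_sum, ← Complex.ofReal_sum]
  change _ * ((mg P S y : ℝ) : ℂ) = _
  by_cases h0 : mg P S y = 0
  · have : P y = 0 := le_antisymm (h0 ▸ le_mg hP S y) (hP y)
    simp [this]
  · have : (mg P S y : ℂ) ≠ 0 := by exact_mod_cast h0
    field_simp

/-- squared norm of the conditional expectation -/
def phi (P : (Fin n → A) → ℝ) (f : (Fin n → A) → ℂ) (S : Finset (Fin n)) : ℝ :=
  ∑ x, P x * Complex.normSq (ce P S f x)

lemma phi_nonneg {P : (Fin n → A) → ℝ} (hP : ∀ x, 0 ≤ P x) (f : (Fin n → A) → ℂ)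
    (S : Finset (Fin n)) : 0 ≤ phi P f S :=
  Finset.sum_nonneg fun x _ => mul_nonneg (hP x) (Complex.normSq_nonneg _)

lemma phi_pyth {P : (Fin n → A) → ℝ} (hP : ∀ x, 0 ≤ P x) (f : (Fin n → A) → ℂ)
    {S T : Finset (Fin n)} (hST : S ⊆ T) :
    ∑ x, P x * Complex.normSq (ce P T f x - ce P S f x) = phi P f T - phi P f S := by
  have hc : Dep S (fun x => (starRingEnd ℂ) (ce P S f x)) := by
    intro x y h; simp only [ce_dep P S f x y h]
  have h1 := sum_ce_mul hP T f _ (hc.mono hST)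
  have h2 := sum_ce_mul hP S f _ hc
  have h3 : ∑ x, P x * (ce P T f x * (starRingEnd ℂ) (ce P S f x)).re = phi P f S := by
    have := congrArg Complex.re (h1.trans h2.symm)
    simp only [Complex.re_sum, Complex.re_ofReal_mul] at this
    rw [this]
    unfold phi
    simp [Complex.mul_conj]
  simp_rw [Complex.normSq_sub, mul_sub, mul_add, Finset.sum_sub_distrib, Finset.sum_add_distrib]
  have h4 : ∑ x, P x * (2 * (ce P T f x * (starRingEnd ℂ) (ce P S f x)).re) = 2 * phi P f S := by
    rw [← h3, Finset.mul_sum]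
    exact Finset.sum_congr rfl fun x _ => by ring
  rw [h4]
  unfold phi
  ring

lemma phi_mono {P : (Fin n → A) → ℝ} (hP : ∀ x, 0 ≤ P x) (f : (Fin n → A) → ℂ)
    {S T : Finset (Fin n)} (hST : S ⊆ T) : phi P f S ≤ phi P f T := by
  have := phi_pyth hP f hST
  have h2 : 0 ≤ ∑ x, P x * Complex.normSq (ce P T f x - ce P S f x) :=
    Finset.sum_nonneg fun x _ => mul_nonneg (hP x) (Complex.normSq_nonneg _)
  linarith

lemma norm_ce_le {P : (Fin n → A) → ℝ} (hP : ∀ x, 0 ≤ P x) (S : Finset (Fin n))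
    (f : (Fin n → A) → ℂ) {B : ℝ} (hB : 0 ≤ B) (hf : ∀ x, ‖f x‖ ≤ B) (x : Fin n → A) :
    ‖ce P S f x‖ ≤ B := by
  unfold ce
  rw [norm_div, Complex.norm_real, Real.norm_of_nonneg (mg_nonneg hP S x)]
  refine div_le_of_le_mul₀ (mg_nonneg hP S x) hB ?_
  refine (norm_sum_le _ _).trans ?_
  unfold mg
  rw [Finset.mul_sum]
  refine Finset.sum_le_sum fun y _ => ?_
  split_ifs
  · rw [norm_mul, Complex.norm_real, Real.norm_of_nonneg (hP y), mul_comm]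
    exact mul_le_mul_of_nonneg_right (hf y) (hP y)
  · simp

lemma phi_le {P : (Fin n → A) → ℝ} (hP : ∀ x, 0 ≤ P x) (h1 : ∑ x, P x = 1) (S : Finset (Fin n))
    (f : (Fin n → A) → ℂ) {B : ℝ} (hB : 0 ≤ B) (hf : ∀ x, ‖f x‖ ≤ B) :
    phi P f S ≤ B ^ 2 := by
  unfold phi
  calc _ ≤ ∑ x, P x * B ^ 2 := by
        refine Finset.sum_le_sum fun x _ => mul_le_mul_of_nonneg_left ?_ (hP x)
        rw [Complex.normSq_eq_norm_sq]
        exact pow_le_pow_left₀ (norm_nonneg _) (norm_ce_le hP S f hB hf x) 2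
    _ = B ^ 2 := by rw [← Finset.sum_mul, h1, one_mul]

lemma key_diff {P : (Fin n → A) → ℝ} (hP : ∀ x, 0 ≤ P x) (h1 : ∑ x, P x = 1)
    {S T : Finset (Fin n)} (hST : S ⊆ T) (f g : (Fin n → A) → ℂ) (hg : Dep T g) {B : ℝ}
    (hB : 0 ≤ B) (hgB : ∀ x, ‖g x‖ ≤ B) {ε : ℝ} (hε : 0 < ε) :
    ‖∑ x, (P x : ℂ) * (f x * g x) - ∑ x, (P x : ℂ) * (ce P S f x * g x)‖ ≤
      B * (ε + (phi P f T - phi P f S) / ε) := by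
  rw [← sum_ce_mul hP T f g hg, ← Finset.sum_sub_distrib]
  refine (norm_sum_le _ _).trans ?_
  rw [← phi_pyth hP f hST]
  have : B * (ε + (∑ x, P x * Complex.normSq (ce P T f x - ce P S f x)) / ε) =
      ∑ x, P x * (B * (ε + Complex.normSq (ce P T f x - ce P S f x) / ε)) := by
    have e1 : ε = ∑ x, P x * ε := by rw [← Finset.sum_mul, h1, one_mul]
    conv_lhs => enter [2, 1]; rw [e1]
    rw [Finset.sum_div, ← Finset.sum_add_distrib, Finset.mul_sum]
    exact Finset.sum_congr rfl fun x _ => by ring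
  rw [this]
  refine Finset.sum_le_sum fun x _ => ?_
  rw [← mul_sub, ← sub_mul, norm_mul, norm_mul, Complex.norm_real, Real.norm_of_nonneg (hP x)]
  refine mul_le_mul_of_nonneg_left ?_ (hP x)
  rw [mul_comm, Complex.normSq_eq_norm_sq]
  set a := ‖ce P T f x - ce P S f x‖
  have ha : 0 ≤ a := norm_nonneg _
  refine mul_le_mul (hgB x) ?_ ha hB
  rw [← sub_nonneg]
  have : ε + a ^ 2 / ε - a = ((ε - a / 2) ^ 2 + 3 / 4 * a ^ 2) / ε := by field_simp; ring
  rw [this]; positivity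

lemma hybrid {P : (Fin n → A) → ℝ} (hP : ∀ x, 0 ≤ P x) (h1 : ∑ x, P x = 1)
    (S e : Finset (Fin n)) (f : Fin n → A → ℂ) {B : ℝ} (hB : 1 ≤ B)
    (hf : ∀ u a, ‖f u a‖ ≤ B) {ε : ℝ} (hε : 0 < ε) :
    ‖∑ x, (P x : ℂ) * ∏ u ∈ e, f u (x u) -
      ∑ x, (P x : ℂ) * ∏ u ∈ e, ce P S (fun y => f u (y u)) x‖ ≤
      ∑ u ∈ e, B ^ e.card * (ε + (phi P (fun y => f u (y u)) (S ∪ e.erase u) -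
        phi P (fun y => f u (y u)) S) / ε) := by
  have hB0 : 0 ≤ B := by linarith
  have key : ∀ s : Finset (Fin n), s ⊆ e →
    ‖∑ x, (P x : ℂ) * ∏ u ∈ e, f u (x u) -
      ∑ x, (P x : ℂ) * ∏ u ∈ e, (if u ∈ s then ce P S (fun y => f u (y u)) x else f u (x u))‖ ≤
      ∑ u ∈ s, B ^ e.card * (ε + (phi P (fun y => f u (y u)) (S ∪ e.erase u) -
        phi P (fun y => f u (y u)) S) / ε) := by
    intro s
    induction s using Finset.induction_on with
    | empty => intro _; simp
    | insert u s hus ih =>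
      intro hs
      have hue : u ∈ e := hs (Finset.mem_insert_self _ _)
      have hse : s ⊆ e := (Finset.subset_insert _ _).trans hs
      rw [Finset.sum_insert hus]
      set g : (Fin n → A) → ℂ := fun x =>
        ∏ v ∈ e.erase u, (if v ∈ s then ce P S (fun y => f v (y v)) x else f v (x v)) with hg
      have e1 : ∀ x, ∏ v ∈ e, (if v ∈ s then ce P S (fun y => f v (y v)) x else f v (x v)) =
          f u (x u) * g x := by
        intro x
        rw [← Finset.mul_prod_erase e _ hue, if_neg hus]
      have e2 : ∀ x, ∏ v ∈ e, (if v ∈ insert u s then ce P S (fun y => f v (y v)) x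
          else f v (x v)) = ce P S (fun y => f u (y u)) x * g x := by
        intro x
        rw [← Finset.mul_prod_erase e _ hue, if_pos (Finset.mem_insert_self _ _)]
        congr 1
        refine Finset.prod_congr rfl fun v hv => ?_
        have : v ≠ u := Finset.ne_of_mem_erase hv
        simp [Finset.mem_insert, this]
      have hgd : Dep (S ∪ e.erase u) g := by
        intro x y hxy
        refine Finset.prod_congr rfl fun v hv => ?_
        split_ifs
        · exact (ce_dep P S _).mono Finset.subset_union_left x y hxy
        · rw [hxy v (Finset.mem_union_right _ hv)]
      have hgB : ∀ x, ‖g x‖ ≤ B ^ e.card := by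
        intro x
        calc ‖g x‖ ≤ ∏ v ∈ e.erase u, B := by
              rw [hg]; simp only [norm_prod]
              refine Finset.prod_le_prod (fun _ _ => norm_nonneg _) fun v _ => ?_
              split_ifs
              · exact norm_ce_le hP S _ hB0 (fun x => hf v (x v)) x
              · exact hf v _
          _ = B ^ (e.erase u).card := by simp
          _ ≤ B ^ e.card := pow_le_pow_right₀ hB (Finset.card_le_card (Finset.erase_subset _ _))
      have := key_diff hP h1 (S := S) (T := S ∪ e.erase u) Finset.subset_union_left
        (fun y => f u (y u)) g hgd (pow_nonneg hB0 e.card) hgB hε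
      have ih' := ih hse
      simp_rw [e1] at ih'
      simp_rw [e2]
      calc _ ≤ _ := norm_sub_le_norm_sub_add_norm_sub _ (∑ x, (P x : ℂ) * (f u (x u) * g x)) _
        _ ≤ _ := by rw [add_comm]; exact add_le_add this ih'
  have h := key e subset_rfl
  have e3 : ∀ x : Fin n → A, ∏ u ∈ e, (if u ∈ e then ce P S (fun y => f u (y u)) x else f u (x u)) =
      ∏ u ∈ e, ce P S (fun y => f u (y u)) x := fun x =>
    Finset.prod_congr rfl fun u hu => if_pos hu
  simpa only [e3] using h

end Classical

/-! ### Averaging over randomly chosen sets of sites -/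

section Averaging

variable {n : ℕ}

/-- average over adding one uniformly random site -/
def avg (φ : Finset (Fin n) → ℝ) : Finset (Fin n) → ℝ :=
  fun S => (∑ v, φ (insert v S)) / n

lemma avg_mono {φ ψ : Finset (Fin n) → ℝ} (h : φ ≤ ψ) : avg φ ≤ avg ψ := fun S => by
  unfold avg
  gcongr with v
  exact h _

lemma avg_iter_mono {φ ψ : Finset (Fin n) → ℝ} (h : φ ≤ ψ) (t : ℕ) :
    avg^[t] φ ≤ avg^[t] ψ := by
  induction t with
  | zero => exact h
  | succ t ih => rw [Function.iterate_succ_apply', Function.iterate_succ_apply']; exact avg_mono ih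

lemma avg_add (φ ψ : Finset (Fin n) → ℝ) : avg (φ + ψ) = avg φ + avg ψ := by
  funext S; simp [avg, Finset.sum_add_distrib, add_div]

lemma avg_smul (c : ℝ) (φ : Finset (Fin n) → ℝ) : avg (c • φ) = c • avg φ := by
  funext S; simp [avg, ← Finset.mul_sum, mul_div_assoc]

/-- `avg` as a linear map -/
def avgL (n : ℕ) : (Finset (Fin n) → ℝ) →ₗ[ℝ] (Finset (Fin n) → ℝ) where
  toFun := avg
  map_add' := avg_add
  map_smul' := avg_smul

lemma avgL_apply (φ : Finset (Fin n) → ℝ) : avgL n φ = avg φ := rfl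

lemma avgL_pow_apply (t : ℕ) (φ : Finset (Fin n) → ℝ) : (avgL n ^ t) φ = avg^[t] φ := by
  rw [Module.End.pow_apply]; rfl

lemma avgL_pow_mono (t : ℕ) {φ ψ : Finset (Fin n) → ℝ} (h : φ ≤ ψ) :
    (avgL n ^ t) φ ≤ (avgL n ^ t) ψ := by
  rw [avgL_pow_apply, avgL_pow_apply]; exact avg_iter_mono h t

lemma avgL_const (hn : 0 < n) (c : ℝ) : avgL n (fun _ => c) = fun _ => c := by
  funext S
  have : (n : ℝ) ≠ 0 := by positivity
  simp [avgL_apply, avg]; field_simp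

lemma avgL_pow_const (hn : 0 < n) (t : ℕ) (c : ℝ) : (avgL n ^ t) (fun _ => c) = fun _ => c := by
  induction t with
  | zero => simp
  | succ t ih => rw [pow_succ', Module.End.mul_apply, ih, avgL_const hn]

/-- If the averages are small then some set is good. -/
lemma exists_le_of_avg (hn : 0 < n) (φ : Finset (Fin n) → ℝ) (L : ℕ) (hL : 0 < L) (c : ℝ)
    (h : ∑ t ∈ Finset.range L, (avgL n ^ t) φ ∅ ≤ L * c) : ∃ S, φ S ≤ c := by
  by_contra! hc
  obtain ⟨S0, hS0⟩ := Finite.exists_min φ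
  have h1 : (fun _ => φ S0) ≤ φ := hS0
  have h2 : ∀ t, φ S0 ≤ (avgL n ^ t) φ ∅ := fun t => by
    have := avgL_pow_mono t h1 ∅
    rwa [avgL_pow_const hn] at this
  have h3 : (L : ℝ) * φ S0 ≤ L * c := by
    refine le_trans ?_ h
    have := Finset.card_nsmul_le_sum (Finset.range L) (fun t => (avgL n ^ t) φ ∅) (φ S0)
      (fun t _ => h2 t)
    simpa using this
  have : (0 : ℝ) < L := by exact_mod_cast hL
  have := le_of_mul_le_mul_left h3 this
  exact absurd (hc S0) (not_lt.mpr this)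

lemma sum_powersetCard_le (hn : 0 < n) (ψ : Finset (Fin n) → ℝ) (hψ : ∀ S, 0 ≤ ψ S) (r : ℕ)
    (S : Finset (Fin n)) :
    ∑ T ∈ Finset.powersetCard r Finset.univ, ψ (S ∪ T) ≤ (n : ℝ) ^ r * (avgL n ^ r) ψ S := by
  induction r generalizing S with
  | zero => simp
  | succ r ih =>
    have hsub : Finset.powersetCard (r + 1) (Finset.univ : Finset (Fin n)) ⊆
        (Finset.univ ×ˢ Finset.powersetCard r Finset.univ).image
          (fun p : Fin n × Finset (Fin n) => insert p.1 p.2) := by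
      intro T hT
      rw [Finset.mem_powersetCard_univ] at hT
      obtain ⟨v, hv⟩ : T.Nonempty := Finset.card_pos.mp (by omega)
      refine Finset.mem_image.mpr ⟨(v, T.erase v), ?_, Finset.insert_erase hv⟩
      simp [Finset.mem_powersetCard_univ, Finset.card_erase_of_mem hv, hT]
    calc ∑ T ∈ Finset.powersetCard (r + 1) Finset.univ, ψ (S ∪ T)
        ≤ ∑ T ∈ (Finset.univ ×ˢ Finset.powersetCard r Finset.univ).image
          (fun p : Fin n × Finset (Fin n) => insert p.1 p.2), ψ (S ∪ T) :=
          Finset.sum_le_sum_of_subset_of_nonneg hsub fun _ _ _ => hψ _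
      _ ≤ ∑ p ∈ Finset.univ ×ˢ Finset.powersetCard r Finset.univ,
          ψ (S ∪ insert p.1 p.2) := by
          exact Finset.sum_image_le_of_nonneg (f := fun T => ψ (S ∪ T)) (fun _ _ => hψ _)
      _ = ∑ v, ∑ T ∈ Finset.powersetCard r Finset.univ, ψ (insert v S ∪ T) := by
          rw [Finset.sum_product]
          refine Finset.sum_congr rfl fun v _ => Finset.sum_congr rfl fun T _ => ?_
          congr 1
          rw [Finset.union_insert, Finset.insert_union]
      _ ≤ ∑ v, (n : ℝ) ^ r * (avgL n ^ r) ψ (insert v S) :=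
          Finset.sum_le_sum fun v _ => ih _
      _ = _ := by
          rw [pow_succ' (avgL n), Module.End.mul_apply, avgL_apply]
          have : (n : ℝ) ≠ 0 := by positivity
          unfold avg
          rw [← Finset.mul_sum]
          field_simp
          ring

lemma telescope_le (a : ℕ → ℝ) (D : ℝ) (h0 : ∀ t, 0 ≤ a t) (hD : ∀ t, a t ≤ D) (L r : ℕ) :
    ∑ t ∈ Finset.range L, (a (t + r) - a t) ≤ r * D := by
  induction r with
  | zero => simp
  | succ r ih =>
    have h1 : ∑ t ∈ Finset.range L, (a (t + 1 + r) - a (t + r)) = a (L + r) - a (0 + r) :=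
      Finset.sum_range_sub (fun t => a (t + r)) L
    have h2 : ∑ t ∈ Finset.range L, (a (t + (r + 1)) - a t) =
        ∑ t ∈ Finset.range L, (a (t + 1 + r) - a (t + r)) +
        ∑ t ∈ Finset.range L, (a (t + r) - a t) := by
      rw [← Finset.sum_add_distrib]
      refine Finset.sum_congr rfl fun t _ => ?_
      rw [show t + 1 + r = t + (r + 1) by ring]; ring
    rw [h2, h1]
    push_cast
    linarith [h0 (0 + r), hD (L + r)]

/-- number of touched hyperedges -/
def touched (E : Finset (Finset (Fin n))) (S : Finset (Fin n)) : ℝ :=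
  ∑ e ∈ E, if Disjoint e S then 0 else 1

lemma touched_insert (E : Finset (Finset (Fin n))) (S : Finset (Fin n)) (v : Fin n) :
    touched E (insert v S) ≤ touched E S + ∑ e ∈ E, if v ∈ e then 1 else 0 := by
  unfold touched
  rw [← Finset.sum_add_distrib]
  refine Finset.sum_le_sum fun e _ => ?_
  by_cases h1 : Disjoint e S <;> by_cases h2 : v ∈ e <;>
    simp [h1, h2, Finset.disjoint_insert_right]

lemma avg_touched_le (E : Finset (Finset (Fin n))) (k : ℕ) (hk : ∀ e ∈ E, e.card = k)
    (hn : 0 < n) :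
    avgL n (touched E) ≤ touched E + fun _ => (k * E.card / n : ℝ) := by
  intro S
  have hn' : (0 : ℝ) < n := by exact_mod_cast hn
  rw [avgL_apply]
  unfold avg
  rw [div_le_iff₀ hn']
  calc _ ≤ ∑ v, (touched E S + ∑ e ∈ E, if v ∈ e then (1 : ℝ) else 0) :=
        Finset.sum_le_sum fun v _ => touched_insert E S v
    _ = n * touched E S + ∑ e ∈ E, (e.card : ℝ) := by
        rw [Finset.sum_add_distrib, Finset.sum_comm]
        simp
    _ = n * touched E S + E.card * k := by
        rw [Finset.sum_congr rfl fun e he => by rw [hk e he]]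
        simp
    _ = _ := by
        simp only [Pi.add_apply]
        field_simp

lemma avg_pow_touched_le (E : Finset (Finset (Fin n))) (k : ℕ) (hk : ∀ e ∈ E, e.card = k)
    (hn : 0 < n) (t : ℕ) :
    (avgL n ^ t) (touched E) ∅ ≤ t * (k * E.card / n : ℝ) := by
  have key : (avgL n ^ t) (touched E) ≤ touched E + fun _ => t * (k * E.card / n : ℝ) := by
    induction t with
    | zero => intro S; simp
    | succ t ih =>
      rw [pow_succ', Module.End.mul_apply]
      have h1 := avgL_pow_mono 1 ih
      rw [pow_one, map_add, avgL_const hn] at h1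
      refine h1.trans ?_
      intro S
      have := avg_touched_le E k hk hn S
      simp only [Pi.add_apply] at *
      push_cast
      linarith
  have := key ∅
  simpa [touched] using this

/-- The main averaging statement. -/
lemma averaging (hn : 0 < n) (E : Finset (Finset (Fin n))) (k : ℕ) (hk0 : 0 < k)
    (hk : ∀ e ∈ E, e.card = k)
    (Φ : Fin n → Finset (Fin n) → ℝ) (D : ℝ) (h0 : ∀ u S, 0 ≤ Φ u S) (hD : ∀ u S, Φ u S ≤ D)
    (hmono : ∀ u S T, S ⊆ T → Φ u S ≤ Φ u T) (L : ℕ) (hL : 0 < L)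
    (K1 K2 ε : ℝ) (hK1 : 0 ≤ K1) (hK2 : 0 ≤ K2) (hε : 0 < ε) :
    ∃ S, K1 * touched E S +
        K2 * ∑ e ∈ E, ∑ u ∈ e, (ε + (Φ u (S ∪ e.erase u) - Φ u S) / ε) ≤
      K1 * (L * (k * E.card / n)) + K2 * (k * E.card * ε + k * n ^ k * D / (ε * L)) := by
  have hn' : (0 : ℝ) < n := by exact_mod_cast hn
  have hL' : (0 : ℝ) < L := by exact_mod_cast hL
  have hD0 : 0 ≤ D := (h0 ⟨0, hn⟩ ∅).trans (hD _ _)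
  set Ψ : Finset (Fin n) → ℝ := ∑ u, Φ u with hΨ
  -- the pointwise bound
  have hpt : ∀ S, ∑ e ∈ E, ∑ u ∈ e, (Φ u (S ∪ e.erase u) - Φ u S) ≤
      (n : ℝ) ^ (k - 1) * ((avgL n ^ (k - 1)) Ψ S - Ψ S) := by
    intro S
    have hu : ∀ u, ∑ e ∈ E, (if u ∈ e then (Φ u (S ∪ e.erase u) - Φ u S) else 0) ≤
        (n : ℝ) ^ (k - 1) * ((avgL n ^ (k - 1)) (Φ u) S - Φ u S) := by
      intro u
      have hinj : Set.InjOn (fun e : Finset (Fin n) => e.erase u) ({e ∈ E | u ∈ e} : Finset _) := by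
        intro e he e' he' h
        simp only [Finset.coe_filter, Set.mem_ofPred_eq] at he he'
        have h : e.erase u = e'.erase u := h
        rw [← Finset.insert_erase he.2, ← Finset.insert_erase he'.2, h]
      rw [← Finset.sum_filter]
      have e1 : ∑ e ∈ E with u ∈ e, (Φ u (S ∪ e.erase u) - Φ u S) =
          ∑ T ∈ ({e ∈ E | u ∈ e}).image (fun e => e.erase u), (Φ u (S ∪ T) - Φ u S) :=
        (Finset.sum_image (f := fun T => Φ u (S ∪ T) - Φ u S) hinj).symm
      rw [e1]
      have hsub : ({e ∈ E | u ∈ e}).image (fun e => e.erase u) ⊆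
          Finset.powersetCard (k - 1) Finset.univ := by
        intro T hT
        obtain ⟨e, he, rfl⟩ := Finset.mem_image.mp hT
        rw [Finset.mem_filter] at he
        rw [Finset.mem_powersetCard_univ, Finset.card_erase_of_mem he.2, hk e he.1]
      refine (Finset.sum_le_sum_of_subset_of_nonneg hsub fun T _ _ =>
        sub_nonneg.mpr (hmono u _ _ Finset.subset_union_left)).trans ?_
      -- use ψ(T) = Φ u (S ∪ T) - Φ u S
      have h3 := sum_powersetCard_le hn (fun T => Φ u (S ∪ T) - Φ u S)
        (fun T => sub_nonneg.mpr (hmono u _ _ Finset.subset_union_left)) (k - 1) S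
      simp only [Finset.union_left_idem] at h3
      refine h3.trans (le_of_eq ?_)
      congr 1
      have h4 : ∀ (r : ℕ) (φ φ' : Finset (Fin n) → ℝ), (∀ T, S ⊆ T → φ T = φ' T) →
          ∀ T, S ⊆ T → (avgL n ^ r) φ T = (avgL n ^ r) φ' T := by
        intro r
        induction r with
        | zero => intro φ φ' h T hT; simpa using h T hT
        | succ r ih =>
          intro φ φ' h T hT
          rw [pow_succ', Module.End.mul_apply, Module.End.mul_apply, avgL_apply, avgL_apply]
          unfold avg
          congr 1
          exact Finset.sum_congr rfl fun v _ => ih φ φ' h _ (hT.trans (Finset.subset_insert _ _))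
      rw [h4 (k - 1) _ (Φ u - fun _ => Φ u S) (fun T hT => by
        simp [Finset.union_eq_right.mpr hT]) S subset_rfl, map_sub, avgL_pow_const hn]
      rfl
    calc ∑ e ∈ E, ∑ u ∈ e, (Φ u (S ∪ e.erase u) - Φ u S)
        = ∑ e ∈ E, ∑ u, (if u ∈ e then (Φ u (S ∪ e.erase u) - Φ u S) else 0) := by
          refine Finset.sum_congr rfl fun e _ => ?_
          rw [Finset.sum_ite_mem, Finset.univ_inter]
      _ = ∑ u, ∑ e ∈ E, (if u ∈ e then (Φ u (S ∪ e.erase u) - Φ u S) else 0) := Finset.sum_comm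
      _ ≤ ∑ u, (n : ℝ) ^ (k - 1) * ((avgL n ^ (k - 1)) (Φ u) S - Φ u S) :=
          Finset.sum_le_sum fun u _ => hu u
      _ = _ := by
          rw [← Finset.mul_sum, hΨ, map_sum, Finset.sum_apply, Finset.sum_apply,
            Finset.sum_sub_distrib]
  set c0 : ℝ := K2 * (k * E.card * ε) with hc0
  set c1 : ℝ := K2 / ε * (n : ℝ) ^ (k - 1) with hc1
  have hc1' : 0 ≤ c1 := by positivity
  set Err : Finset (Fin n) → ℝ :=
    K1 • touched E + c1 • ((avgL n ^ (k - 1)) Ψ - Ψ) + (fun _ => c0) with hErr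
  have hle : ∀ S, K1 * touched E S +
        K2 * ∑ e ∈ E, ∑ u ∈ e, (ε + (Φ u (S ∪ e.erase u) - Φ u S) / ε) ≤ Err S := by
    intro S
    have e1 : K2 * ∑ e ∈ E, ∑ u ∈ e, (ε + (Φ u (S ∪ e.erase u) - Φ u S) / ε) =
        c0 + K2 / ε * ∑ e ∈ E, ∑ u ∈ e, (Φ u (S ∪ e.erase u) - Φ u S) := by
      have : ∀ e ∈ E, ∑ u ∈ e, (ε + (Φ u (S ∪ e.erase u) - Φ u S) / ε) =
          k * ε + (∑ u ∈ e, (Φ u (S ∪ e.erase u) - Φ u S)) / ε := by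
        intro e he
        rw [Finset.sum_add_distrib, ← Finset.sum_div]
        simp [hk e he]
      rw [Finset.sum_congr rfl this, Finset.sum_add_distrib, ← Finset.sum_div]
      simp [hc0]; ring
    rw [e1]
    have h5 := mul_le_mul_of_nonneg_left (hpt S) (show 0 ≤ K2 / ε by positivity)
    simp only [hErr, Pi.add_apply, Pi.smul_apply, Pi.sub_apply, smul_eq_mul, hc1]
    linarith
  have hmain : ∑ t ∈ Finset.range L, (avgL n ^ t) Err ∅ ≤
      L * (K1 * (L * (k * E.card / n)) + K2 * (k * E.card * ε + k * n ^ k * D / (ε * L))) := by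
    have e2 : ∀ t, (avgL n ^ t) Err ∅ = K1 * (avgL n ^ t) (touched E) ∅ +
        c1 * ((avgL n ^ (t + (k - 1))) Ψ ∅ - (avgL n ^ t) Ψ ∅) + c0 := by
      intro t
      rw [hErr, map_add, map_add, map_smul, map_smul, map_sub, avgL_pow_const hn, pow_add,
        Module.End.mul_apply]
      simp
    have hΨ0 : ∀ S, 0 ≤ Ψ S := fun S => by
      rw [hΨ, Finset.sum_apply]; exact Finset.sum_nonneg fun u _ => h0 u S
    have hΨD : ∀ S, Ψ S ≤ n * D := fun S => by
      rw [hΨ, Finset.sum_apply]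
      refine (Finset.sum_le_sum fun u _ => hD u S).trans ?_
      simp
    have ha0 : ∀ t, 0 ≤ (avgL n ^ t) Ψ ∅ := fun t => by
      have := avgL_pow_mono t (show (fun _ => (0 : ℝ)) ≤ Ψ from hΨ0) ∅
      rwa [avgL_pow_const hn] at this
    have haD : ∀ t, (avgL n ^ t) Ψ ∅ ≤ n * D := fun t => by
      have := avgL_pow_mono t (show Ψ ≤ (fun _ => (n * D : ℝ)) from hΨD) ∅
      rwa [avgL_pow_const hn] at this
    have htel := telescope_le (fun t => (avgL n ^ t) Ψ ∅) (n * D) ha0 haD L (k - 1)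
    simp_rw [e2]
    rw [Finset.sum_add_distrib, Finset.sum_add_distrib, ← Finset.mul_sum, ← Finset.mul_sum]
    have ht : ∑ t ∈ Finset.range L, (avgL n ^ t) (touched E) ∅ ≤ L * (L * (k * E.card / n)) := by
      refine (Finset.sum_le_sum (g := fun _ => (L * (k * E.card / n) : ℝ)) fun t ht => ?_).trans ?_
      · refine (avg_pow_touched_le E k hk hn t).trans ?_
        have : (t : ℝ) ≤ L := by exact_mod_cast (Finset.mem_range.mp ht).le
        gcongr
      · simp
    have h6 := mul_le_mul_of_nonneg_left ht hK1
    have h7 := mul_le_mul_of_nonneg_left htel hc1'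
    have h8 : c1 * (((k - 1 : ℕ) : ℝ) * (n * D)) ≤ L * (K2 * (k * n ^ k * D / (ε * L))) := by
      have : ((k - 1 : ℕ) : ℝ) ≤ k := by exact_mod_cast Nat.sub_le k 1
      calc _ ≤ c1 * ((k : ℝ) * (n * D)) := by gcongr
        _ = _ := by
          obtain ⟨j, rfl⟩ : ∃ j, k = j + 1 := ⟨k - 1, by omega⟩
          simp only [hc1, Nat.add_sub_cancel, pow_succ]
          field_simp
    have h9 : ∑ t ∈ Finset.range L, c0 = L * c0 := by simp
    rw [h9]
    simp only [hc0]
    linarith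
  obtain ⟨S, hS⟩ := exists_le_of_avg hn Err L hL _ hmain
  exact ⟨S, (hle S).trans hS⟩

end Averaging

/-! ### Algebra of product operators -/

lemma herm_spec {m : Type*} [Fintype m] [DecidableEq m] {ρ : Matrix m m ℂ} (hH : ρ.IsHermitian) :
    ∃ U : Matrix m m ℂ, U.conjTranspose * U = 1 ∧ U * U.conjTranspose = 1 ∧
      ρ = U * Matrix.diagonal (fun j => (hH.eigenvalues j : ℂ)) * U.conjTranspose := by
  have hU1 : (hH.eigenvectorUnitary : Matrix m m ℂ).conjTranspose *
      (hH.eigenvectorUnitary : Matrix m m ℂ) = 1 := by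
    have := Unitary.coe_star_mul_self hH.eigenvectorUnitary
    simpa [Matrix.star_eq_conjTranspose] using this
  refine ⟨(hH.eigenvectorUnitary : Matrix m m ℂ), hU1, mul_eq_one_comm.mp hU1, ?_⟩
  have := hH.spectral_theorem
  rw [Unitary.conjStarAlgAut_apply] at this
  exact this

lemma psd_factor {m : Type*} [Fintype m] [DecidableEq m] {B : Matrix m m ℂ}
    (hB : B.PosSemidef) : ∃ C : Matrix m m ℂ, B = C.conjTranspose * C := by
  obtain ⟨U, -, -, h⟩ := herm_spec hB.isHermitian
  refine ⟨Matrix.diagonal (fun j => (Real.sqrt (hB.isHermitian.eigenvalues j) : ℂ)) *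
    U.conjTranspose, ?_⟩
  conv_lhs => rw [h]
  rw [Matrix.conjTranspose_mul, Matrix.conjTranspose_conjTranspose, Matrix.diagonal_conjTranspose,
    Matrix.mul_assoc, Matrix.mul_assoc, ← Matrix.mul_assoc (Matrix.diagonal _) (Matrix.diagonal _),
    Matrix.diagonal_mul_diagonal]
  congr 3
  funext j
  simp only [Pi.star_apply, Complex.star_def, Complex.conj_ofReal]
  rw [← Complex.ofReal_mul, Real.mul_self_sqrt (hB.eigenvalues_nonneg j)]

section Prod

variable {n d : ℕ}

lemma prodState_mul (B C : Fin n → Matrix (Fin d) (Fin d) ℂ) :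
    prodState (fun u => B u * C u) = prodState B * prodState C := by
  ext x y
  simp only [prodState, Matrix.mul_apply]
  rw [Finset.prod_univ_sum, Fintype.piFinset_univ]
  exact Finset.sum_congr rfl fun z _ => Finset.prod_mul_distrib

lemma prodState_conjTranspose (B : Fin n → Matrix (Fin d) (Fin d) ℂ) :
    prodState (fun u => (B u).conjTranspose) = (prodState B).conjTranspose := by
  ext x y
  simp [prodState, Matrix.conjTranspose_apply]

lemma prodState_diagonal (l : Fin n → Fin d → ℂ) :
    prodState (fun u => Matrix.diagonal (l u)) =
      Matrix.diagonal (fun x : Fin n → Fin d => ∏ u, l u (x u)) := by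
  ext x y
  by_cases h : x = y
  · subst h; simp [prodState]
  · rw [Matrix.diagonal_apply_ne _ h]
    obtain ⟨u, hu⟩ := Function.ne_iff.mp h
    exact Finset.prod_eq_zero (Finset.mem_univ u) (Matrix.diagonal_apply_ne _ hu)

lemma prodState_one : prodState (fun _ : Fin n => (1 : Matrix (Fin d) (Fin d) ℂ)) = 1 := by
  have := prodState_diagonal (n := n) (d := d) (fun _ _ => 1)
  simpa using this

lemma prodState_sum {ι : Type*} [Fintype ι] [DecidableEq ι]
    (F : Fin n → ι → Matrix (Fin d) (Fin d) ℂ) :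
    prodState (fun u => ∑ a, F u a) = ∑ j : Fin n → ι, prodState (fun u => F u (j u)) := by
  ext x y
  simp only [prodState, Matrix.sum_apply]
  rw [Finset.prod_univ_sum, Fintype.piFinset_univ]

lemma prodState_smul (c : Fin n → ℂ) (F : Fin n → Matrix (Fin d) (Fin d) ℂ) :
    prodState (fun u => c u • F u) = (∏ u, c u) • prodState F := by
  ext x y
  simp [prodState, Finset.prod_mul_distrib]

lemma trace_prodState (B : Fin n → Matrix (Fin d) (Fin d) ℂ) :
    (prodState B).trace = ∏ u, (B u).trace := by
  simp only [prodState, Matrix.trace, Matrix.diag_apply]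
  rw [Finset.prod_univ_sum, Fintype.piFinset_univ]

lemma prodState_posSemidef {B : Fin n → Matrix (Fin d) (Fin d) ℂ} (h : ∀ u, (B u).PosSemidef) :
    (prodState B).PosSemidef := by
  have : ∀ u, ∃ C : Matrix (Fin d) (Fin d) ℂ, B u = C.conjTranspose * C := fun u => psd_factor (h u)
  choose C hC using this
  have e : B = fun u => (C u).conjTranspose * C u := funext hC
  rw [e, prodState_mul, prodState_conjTranspose]
  exact Matrix.posSemidef_conjTranspose_mul_self _

lemma isDensity_prodState {B : Fin n → Matrix (Fin d) (Fin d) ℂ} (h : ∀ u, IsDensity (B u)) :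
    IsDensity (prodState B) :=
  ⟨prodState_posSemidef fun u => (h u).1, by rw [trace_prodState]; simp [fun u => (h u).2]⟩

lemma trace_mul_nonneg {m : Type*} [Fintype m] [DecidableEq m] {A B : Matrix m m ℂ}
    (hA : A.PosSemidef) (hB : B.PosSemidef) : 0 ≤ (A * B).trace := by
  obtain ⟨C, rfl⟩ := psd_factor hA
  rw [Matrix.mul_assoc, Matrix.trace_mul_comm, Matrix.mul_assoc]
  have := hB.mul_mul_conjTranspose_same C
  rw [Matrix.mul_assoc] at this
  exact this.trace_nonneg

/-- the multilinear expansion with one marked site -/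
lemma sum_prodState_marked {ι : Type*} [Fintype ι] [DecidableEq ι]
    (F : Fin n → ι → Matrix (Fin d) (Fin d) ℂ) (u : Fin n) (l : ι → ℂ) :
    ∑ j : Fin n → ι, l (j u) • prodState (fun v => F v (j v)) =
      ∑ a, l a • prodState (Function.update (fun v => ∑ b, F v b) u (F u a)) := by
  have h1 : ∀ j : Fin n → ι, l (j u) • prodState (fun v => F v (j v)) =
      prodState (fun v => (if v = u then l (j v) else 1) • F v (j v)) := by
    intro j
    rw [prodState_smul (fun v => if v = u then l (j v) else 1)]
    simp
  simp_rw [h1]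
  rw [← prodState_sum (fun v a => (if v = u then l a else 1) • F v a)]
  ext x y
  rw [Matrix.sum_apply]
  simp only [prodState, Matrix.smul_apply, smul_eq_mul]
  rw [← Finset.mul_prod_erase _ _ (Finset.mem_univ u)]
  have h2 : ∀ a, ∏ v, Function.update (fun v => ∑ b, F v b) u (F u a) v (x v) (y v) =
      F u a (x u) (y u) * ∏ v ∈ Finset.univ.erase u, (∑ b, F v b) (x v) (y v) := by
    intro a
    rw [← Finset.mul_prod_erase _ _ (Finset.mem_univ u), Function.update_self]
    congr 1
    refine Finset.prod_congr rfl fun v hv => ?_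
    rw [Function.update_of_ne (Finset.ne_of_mem_erase hv)]
  simp_rw [h2, ← mul_assoc]
  rw [← Finset.sum_mul]
  congr 1
  · simp [Matrix.sum_apply]
  · refine Finset.prod_congr rfl fun v hv => ?_
    simp [Finset.ne_of_mem_erase hv]

end Prod

/-! ### Entropy of diagonalized matrices -/

section Entropy

lemma entropy_of_conj {m : Type*} [Fintype m] [DecidableEq m] (U : Matrix m m ℂ)
    (hU : U.conjTranspose * U = 1) (μ : m → ℝ) :
    entropy (U * Matrix.diagonal (fun i => (μ i : ℂ)) * U.conjTranspose) =
      -∑ i, μ i * Real.log (μ i) := by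
  set ρ := U * Matrix.diagonal (fun i => (μ i : ℂ)) * U.conjTranspose with hρ
  have hH : ρ.IsHermitian := by
    refine Matrix.isHermitian_mul_mul_conjTranspose U ?_
    rw [Matrix.isHermitian_diagonal_iff]
    intro i
    simp [IsSelfAdjoint]
  have hU' : U * U.conjTranspose = 1 := mul_eq_one_comm.mp hU
  unfold entropy
  rw [dif_pos hH]
  have hc : ρ.charpoly = (Matrix.diagonal (fun i => (μ i : ℂ))).charpoly := by
    have := Matrix.charpoly_units_conj (⟨U, U.conjTranspose, hU', hU⟩ : (Matrix m m ℂ)ˣ)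
      (Matrix.diagonal (fun i => (μ i : ℂ)))
    rw [hρ, ← Matrix.inv_eq_right_inv hU']
    simpa using this
  have h1 := hH.roots_charpoly_eq_eigenvalues
  rw [hc, Matrix.charpoly_diagonal] at h1
  have h1' : (∏ i, (Polynomial.X - Polynomial.C (μ i : ℂ))).roots =
      Multiset.map (fun i => (μ i : ℂ)) Finset.univ.val := by
    rw [← Polynomial.roots_multiset_prod_X_sub_C (Multiset.map (fun i => (μ i : ℂ)) _),
      Multiset.map_map]
    rfl
  rw [h1'] at h1
  have h2 := congrArg (fun s => (s.map (fun z : ℂ => z.re * Real.log z.re)).sum) h1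
  simp only [Multiset.map_map, Function.comp_def] at h2
  have h3 : ∑ i, μ i * Real.log (μ i) = ∑ i, hH.eigenvalues i * Real.log (hH.eigenvalues i) := by
    simpa using h2
  rw [h3]

/-- Klein-type bound: the entropy is bounded through a fine-grained POVM `F` and subnormalized
weights `Λ`. -/
lemma entropy_le_of_povm {m ι : Type*} [Fintype m] [DecidableEq m] [Fintype ι]
    (ρ : Matrix m m ℂ) (hρ : IsDensity ρ) (F : ι → Matrix m m ℂ) (hF : ∀ i, (F i).PosSemidef)
    (hF1 : ∑ i, F i = 1) (Λ : ι → ℝ) (hΛ : ∀ i, 0 ≤ Λ i)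
    (hΛ1 : ∑ i, (F i).trace.re * Λ i ≤ 1)
    (hz : ∀ i, Λ i = 0 → (F i * ρ).trace.re = 0) :
    entropy ρ ≤ -∑ i, (F i * ρ).trace.re * Real.log (Λ i) := by
  have hH : ρ.IsHermitian := hρ.1.isHermitian
  unfold entropy
  rw [dif_pos hH]
  set r := hH.eigenvalues with hr
  have hr0 : ∀ j, 0 ≤ r j := fun j => hρ.1.eigenvalues_nonneg j
  obtain ⟨U, hU1, hU2, hspec⟩ := herm_spec hH
  -- weights
  set G : ι → Matrix m m ℂ := fun i => U.conjTranspose * F i * U with hG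
  have hGpsd : ∀ i, (G i).PosSemidef := fun i => (hF i).conjTranspose_mul_mul_same U
  set w : m → ι → ℝ := fun j i => (G i j j).re with hw
  have hw0 : ∀ j i, 0 ≤ w j i := fun j i => by
    have := (hGpsd i).diag_nonneg (i := j)
    exact (Complex.le_def.mp this).1
  have hw1 : ∀ j, ∑ i, w j i = 1 := fun j => by
    have : ∑ i, G i = 1 := by
      simp only [hG]
      rw [← Finset.sum_mul, ← Finset.mul_sum, hF1, mul_one, hU1]
    have h2 := congrFun (congrFun this j) j
    rw [Matrix.sum_apply] at h2
    have h3 := congrArg Complex.re h2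
    simpa [Complex.re_sum] using h3
  have htr : ∀ i, (F i).trace.re = ∑ j, w j i := fun i => by
    have : (F i).trace = (G i).trace := by
      simp only [hG]
      rw [Matrix.trace_mul_comm, ← Matrix.mul_assoc, hU2, Matrix.one_mul]
    rw [this, Matrix.trace, Complex.re_sum]
    rfl
  have htrρ : ∀ i, (F i * ρ).trace.re = ∑ j, r j * w j i := fun i => by
    have : (F i * ρ).trace = (G i * Matrix.diagonal (fun j => (r j : ℂ))).trace := by
      simp only [hG]
      conv_lhs => rw [hspec]
      rw [← Matrix.mul_assoc, Matrix.trace_mul_comm]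
      simp only [Matrix.mul_assoc, hr]
    rw [this, Matrix.trace, Complex.re_sum]
    refine Finset.sum_congr rfl fun j _ => ?_
    simp [Matrix.mul_diagonal, hw, mul_comm]
  have hr1 : ∑ j, r j = 1 := by
    have h1 := hH.trace_eq_sum_eigenvalues
    rw [hρ.2] at h1
    have h2 := congrArg Complex.re h1
    simpa [Complex.re_sum] using h2.symm
  -- pointwise inequality
  have hpt : ∀ j i, r j * w j i * Real.log (Λ i) - r j * w j i * Real.log (r j) ≤
      w j i * Λ i - r j * w j i := by
    intro j i
    by_cases h0 : r j * w j i = 0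
    · rw [h0]; simpa using mul_nonneg (hw0 j i) (hΛ i)
    · have hrj : 0 < r j := lt_of_le_of_ne (hr0 j) fun h => h0 (by rw [← h]; simp)
      have hwj : 0 < w j i := lt_of_le_of_ne (hw0 j i) fun h => h0 (by rw [← h]; simp)
      have hΛi : 0 < Λ i := by
        refine lt_of_le_of_ne (hΛ i) fun h => h0 ?_
        have h1 := hz i h.symm
        rw [htrρ] at h1
        exact (Finset.sum_eq_zero_iff_of_nonneg fun j _ => mul_nonneg (hr0 j) (hw0 j i)).mp h1 j
          (Finset.mem_univ _)
      rw [← mul_sub, ← Real.log_div hΛi.ne' hrj.ne']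
      have := Real.log_le_sub_one_of_pos (div_pos hΛi hrj)
      calc _ ≤ r j * w j i * (Λ i / r j - 1) := by gcongr
        _ = _ := by field_simp
  have hsum := Finset.sum_le_sum fun j (_ : j ∈ Finset.univ) =>
    Finset.sum_le_sum fun i (_ : i ∈ (Finset.univ : Finset ι)) => hpt j i
  simp only [Finset.sum_sub_distrib] at hsum
  have s1 : ∑ j, ∑ i, r j * w j i * Real.log (Λ i) =
      ∑ i, (F i * ρ).trace.re * Real.log (Λ i) := by
    rw [Finset.sum_comm]
    refine Finset.sum_congr rfl fun i _ => ?_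
    rw [htrρ, Finset.sum_mul]
  have s2 : ∑ j, ∑ i, r j * w j i * Real.log (r j) = ∑ j, r j * Real.log (r j) := by
    refine Finset.sum_congr rfl fun j _ => ?_
    rw [← Finset.sum_mul, ← Finset.mul_sum, hw1, mul_one]
  have s3 : ∑ j, ∑ i, w j i * Λ i = ∑ i, (F i).trace.re * Λ i := by
    rw [Finset.sum_comm]
    refine Finset.sum_congr rfl fun i _ => ?_
    rw [htr, Finset.sum_mul]
  have s4 : ∑ j, ∑ i, r j * w j i = 1 := by
    rw [← hr1]
    refine Finset.sum_congr rfl fun j _ => ?_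
    rw [← Finset.mul_sum, hw1, mul_one]
  rw [s1, s2, s3, s4] at hsum
  linarith

end Entropy

/-! ### An informationally complete measurement -/

section POVM

/-- outcome set of the measurement -/
abbrev Out (d : ℕ) : Type := Fin d × Fin d × Fin 4

/-- measurement vectors -/
def mvec {d : ℕ} (a : Out d) : Fin d → ℂ := fun p =>
  (if p = a.1 then 1 else 0) + Complex.I ^ (a.2.2 : ℕ) * (if p = a.2.1 then 1 else 0)

/-- measurement operators -/
def Mx {d : ℕ} (a : Out d) : Matrix (Fin d) (Fin d) ℂ :=
  (1 / (8 * d) : ℝ) • Matrix.vecMulVec (mvec a) (star (mvec a))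

/-- coefficients expressing matrix units through measurement operators -/
def cf {d : ℕ} (i j : Fin d) (a : Out d) : ℂ :=
  if a.1 = i ∧ a.2.1 = j then 2 * d * Complex.I ^ (a.2.2 : ℕ) else 0

lemma Mx_psd {d : ℕ} (a : Out d) : (Mx a).PosSemidef := by
  unfold Mx
  exact (Matrix.posSemidef_vecMulVec_self_star (mvec a)).smul (by positivity)

lemma Mx_apply {d : ℕ} (a : Out d) (p q : Fin d) :
    Mx a p q = (1 / (8 * d) : ℂ) * (mvec a p * (starRingEnd ℂ) (mvec a q)) := by
  simp [Mx, Matrix.vecMulVec_apply]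

lemma norm_cf_le {d : ℕ} (i j : Fin d) (a : Out d) : ‖cf i j a‖ ≤ 2 * d := by
  unfold cf
  split_ifs
  · simp
  · simp

lemma four_sum (a b c e : ℂ) :
    ∑ s : Fin 4, (a + Complex.I ^ (s : ℕ) * b) *
      (c + (starRingEnd ℂ) (Complex.I ^ (s : ℕ)) * e) = 4 * (a * c + b * e) := by
  simp [Fin.sum_univ_four, pow_succ]
  ring_nf
  simp [Complex.I_sq]
  ring

lemma four_sum' (a b c e : ℂ) :
    ∑ s : Fin 4, Complex.I ^ (s : ℕ) * ((a + Complex.I ^ (s : ℕ) * b) *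
      (c + (starRingEnd ℂ) (Complex.I ^ (s : ℕ)) * e)) = 4 * (a * e) := by
  simp [Fin.sum_univ_four, pow_succ]
  ring_nf
  simp [Complex.I_sq]
  try ring_nf

lemma conj_delta {d : ℕ} (q x : Fin d) :
    (starRingEnd ℂ) (if q = x then (1 : ℂ) else 0) = if q = x then 1 else 0 := by
  split_ifs <;> simp

lemma mvec_sum {d : ℕ} (i j p q : Fin d) :
    ∑ s : Fin 4, mvec (i, j, s) p * (starRingEnd ℂ) (mvec (i, j, s) q) =
      4 * ((if p = i then 1 else 0) * (if q = i then 1 else 0) +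
        (if p = j then 1 else 0) * (if q = j then 1 else 0)) := by
  rw [← four_sum]
  refine Finset.sum_congr rfl fun s _ => ?_
  simp only [mvec]
  rw [map_add, map_mul, conj_delta, conj_delta]

lemma mvec_sum' {d : ℕ} (i j p q : Fin d) :
    ∑ s : Fin 4, Complex.I ^ (s : ℕ) * (mvec (i, j, s) p * (starRingEnd ℂ) (mvec (i, j, s) q)) =
      4 * ((if p = i then 1 else 0) * (if q = j then 1 else 0)) := by
  rw [← four_sum' _ (if p = j then 1 else 0) (if q = i then 1 else 0)]
  refine Finset.sum_congr rfl fun s _ => ?_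
  simp only [mvec]
  rw [map_add, map_mul, conj_delta, conj_delta]

lemma Mx_sum {d : ℕ} (hd : 0 < d) : ∑ a : Out d, Mx a = 1 := by
  ext p q
  have hd' : (d : ℂ) ≠ 0 := by exact_mod_cast hd.ne'
  rw [Matrix.sum_apply]
  simp only [Mx_apply, ← Finset.mul_sum, Fintype.sum_prod_type, mvec_sum]
  simp only [← Finset.mul_sum, Finset.sum_add_distrib]
  by_cases hpq : p = q
  · subst hpq
    simp
    field_simp
    ring
  · have : ∀ x, (if p = x then (1 : ℂ) else 0) * (if q = x then 1 else 0) = 0 := by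
      intro x
      by_cases h1 : p = x <;> by_cases h2 : q = x <;> simp [h1, h2]
      exact hpq (h1.trans h2.symm)
    simp [this, Matrix.one_apply_ne hpq, hpq]

lemma unit_expand {d : ℕ} (hd : 0 < d) (i j : Fin d) :
    Matrix.single i j (1 : ℂ) = ∑ a : Out d, cf i j a • Mx a := by
  ext p q
  have hd' : (d : ℂ) ≠ 0 := by exact_mod_cast hd.ne'
  rw [Matrix.sum_apply]
  simp only [Matrix.smul_apply, smul_eq_mul]
  have h0 : ∀ a : Out d, cf i j a * Mx a p q =
      if a.1 = i then if a.2.1 = j then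
        (1 / 4 : ℂ) * (Complex.I ^ (a.2.2 : ℕ) * (mvec a p * (starRingEnd ℂ) (mvec a q)))
        else 0 else 0 := by
    intro a
    rw [Mx_apply]
    unfold cf
    by_cases h1 : a.1 = i <;> by_cases h2 : a.2.1 = j <;> simp [h1, h2]
    field_simp
    ring
  simp only [h0, Fintype.sum_prod_type, Finset.sum_ite_irrel, Finset.sum_const_zero,
    Finset.sum_ite_eq', Finset.mem_univ, if_true]
  rw [← Finset.mul_sum]
  rw [mvec_sum', Matrix.single_apply]
  have e1 : (i = p) ↔ (p = i) := eq_comm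
  have e2 : (j = q) ↔ (q = j) := eq_comm
  simp only [e1, e2]
  by_cases h1 : p = i <;> by_cases h2 : q = j <;> simp [h1, h2]

/-- coefficients of a general matrix -/
def cfX {d : ℕ} (X : Matrix (Fin d) (Fin d) ℂ) (a : Out d) : ℂ := ∑ i, ∑ j, X i j * cf i j a

lemma mat_expand {d : ℕ} (hd : 0 < d) (X : Matrix (Fin d) (Fin d) ℂ) :
    X = ∑ a : Out d, cfX X a • Mx a := by
  conv_lhs => rw [Matrix.matrix_eq_sum_single X]
  have : ∀ i j, Matrix.single i j (X i j) = ∑ a : Out d, (X i j * cf i j a) • Mx a := by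
    intro i j
    have h := unit_expand hd i j
    have h2 : Matrix.single i j (X i j) = X i j • Matrix.single i j (1 : ℂ) := by simp
    rw [h2, h, Finset.smul_sum]
    simp only [smul_smul]
  simp only [this, cfX, Finset.sum_smul]
  rw [Finset.sum_comm' (t' := Finset.univ) (s' := fun _ => Finset.univ) (by simp)]
  rw [Finset.sum_congr rfl fun j _ => Finset.sum_comm]
  rw [Finset.sum_comm]
  refine Finset.sum_congr rfl fun a _ => ?_
  rw [Finset.sum_comm]

end POVM

section Tau

variable {n d : ℕ}

/-- outcome distribution of the product measurement -/
def Pr (ρ : Matrix (Fin n → Fin d) (Fin n → Fin d) ℂ) (x : Fin n → Out d) : ℝ :=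
  ((prodState (fun u => Mx (x u))) * ρ).trace.re

variable {ρ : Matrix (Fin n → Fin d) (Fin n → Fin d) ℂ}

lemma Pr_coe (hρ : IsDensity ρ) (x : Fin n → Out d) :
    ((prodState (fun u => Mx (x u))) * ρ).trace = (Pr ρ x : ℂ) := by
  have := trace_mul_nonneg (prodState_posSemidef fun u => Mx_psd (x u)) hρ.1
  rw [Complex.le_def] at this
  apply Complex.ext
  · simp [Pr]
  · simpa using this.2.symm

lemma Pr_nonneg (hρ : IsDensity ρ) (x : Fin n → Out d) : 0 ≤ Pr ρ x :=
  (Complex.le_def.mp (trace_mul_nonneg (prodState_posSemidef fun u => Mx_psd (x u)) hρ.1)).1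

lemma exp_formula (hρ : IsDensity ρ) (b : Fin n → Out d → ℂ) :
    (prodState (fun u => ∑ a, b u a • Mx a) * ρ).trace = ∑ x, (Pr ρ x : ℂ) * ∏ u, b u (x u) := by
  rw [prodState_sum, Finset.sum_mul, Matrix.trace_sum]
  refine Finset.sum_congr rfl fun x _ => ?_
  rw [prodState_smul (fun u => b u (x u)), Matrix.smul_mul, Matrix.trace_smul, Pr_coe hρ,
    smul_eq_mul, mul_comm]

lemma Pr_sum (hd : 0 < d) (hρ : IsDensity ρ) : ∑ x, Pr ρ x = 1 := by
  have h := exp_formula hρ (fun _ _ => 1)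
  simp only [one_smul, Mx_sum hd, prodState_one, Matrix.one_mul, hρ.2, Finset.prod_const_one,
    mul_one] at h
  exact_mod_cast h.symm

/-- the family measuring `S` with outcome `z`, and `X` at site `u` -/
def fam (S : Finset (Fin n)) (z : Fin n → Out d) (u : Fin n) (X : Matrix (Fin d) (Fin d) ℂ) :
    Fin n → Matrix (Fin d) (Fin d) ℂ :=
  fun v => if v = u then X else if v ∈ S then Mx (z v) else 1

lemma trace_fam (hd : 0 < d) (hρ : IsDensity ρ) (S : Finset (Fin n)) (z : Fin n → Out d)
    (u : Fin n) (hu : u ∉ S) (b : Out d → ℂ) :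
    (prodState (fam S z u (∑ a, b a • Mx a)) * ρ).trace =
      ∑ y, if Agree S z y then (Pr ρ y : ℂ) * b (y u) else 0 := by
  have e : fam S z u (∑ a, b a • Mx a) = fun v => ∑ a, (if v = u then b a else
      if v ∈ S then (if a = z v then 1 else 0) else 1) • Mx a := by
    funext v
    unfold fam
    split_ifs
    · rfl
    · simp
    · simp [Mx_sum hd]
  rw [e, exp_formula hρ]
  refine Finset.sum_congr rfl fun y _ => ?_
  rw [← Finset.mul_prod_erase _ _ (Finset.mem_univ u), if_pos rfl]
  have h2 : ∏ v ∈ Finset.univ.erase u, (if v = u then b (y v) else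
      if v ∈ S then (if y v = z v then (1 : ℂ) else 0) else 1) = if Agree S z y then 1 else 0 := by
    split_ifs with h
    · refine Finset.prod_eq_one fun v hv => ?_
      rw [if_neg (Finset.ne_of_mem_erase hv)]
      split_ifs with h1 h2
      · rfl
      · exact absurd (h v h1).symm h2
      · rfl
    · have : ∃ v ∈ S, z v ≠ y v := by
        by_contra! h'; exact h h'
      obtain ⟨v, hv, hne⟩ := this
      have hvu : v ≠ u := fun h => hu (h ▸ hv)
      refine Finset.prod_eq_zero (Finset.mem_erase.mpr ⟨hvu, Finset.mem_univ v⟩) ?_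
      simp [hvu, hv, hne.symm]
  rw [h2]
  split_ifs <;> simp

/-- conditional single-site states -/
def tau (ρ : Matrix (Fin n → Fin d) (Fin n → Fin d) ℂ) (S : Finset (Fin n)) (z : Fin n → Out d)
    (u : Fin n) : Matrix (Fin d) (Fin d) ℂ :=
  if u ∈ S ∨ mg (Pr ρ) S z = 0 then ((1 / d : ℝ) : ℂ) • 1
  else Matrix.of fun j i => ce (Pr ρ) S (fun y => cf i j (y u)) z

lemma tau_dep (ρ : Matrix (Fin n → Fin d) (Fin n → Fin d) ℂ) (S : Finset (Fin n)) :
    Dep S (tau ρ S) := by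
  intro x y h
  funext u
  unfold tau
  rw [mg_dep (Pr ρ) S x y h]
  split_ifs
  · rfl
  · ext j i; exact ce_dep (Pr ρ) S _ x y h

lemma tau_trace (hd : 0 < d) (hρ : IsDensity ρ) (S : Finset (Fin n)) (z : Fin n → Out d)
    (u : Fin n) (hu : u ∉ S) (X : Matrix (Fin d) (Fin d) ℂ) :
    (prodState (fam S z u X) * ρ).trace = (mg (Pr ρ) S z : ℂ) * (X * tau ρ S z u).trace := by
  have h1 := trace_fam hd hρ S z u hu (cfX X)
  rw [← mat_expand hd X] at h1
  rw [h1]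
  by_cases h0 : mg (Pr ρ) S z = 0
  · rw [h0, Complex.ofReal_zero, zero_mul]
    refine Finset.sum_eq_zero fun y _ => ?_
    split_ifs with h
    · have : Pr ρ y = 0 := by
        refine le_antisymm ?_ (Pr_nonneg hρ y)
        have := le_mg (Pr_nonneg hρ) S y
        rwa [← mg_dep (Pr ρ) S z y h, h0] at this
      simp [this]
    · rfl
  · have h0' : (mg (Pr ρ) S z : ℂ) ≠ 0 := by exact_mod_cast h0
    have e1 : (X * tau ρ S z u).trace = ∑ i, ∑ j, X i j * ce (Pr ρ) S (fun y => cf i j (y u)) z := by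
      unfold tau
      rw [if_neg (by tauto)]
      simp only [Matrix.trace, Matrix.diag_apply, Matrix.mul_apply, Matrix.of_apply]
    rw [e1]
    unfold ce
    simp_rw [mul_div_assoc', ← Finset.sum_div]
    rw [mul_div_cancel₀ _ h0']
    simp_rw [Finset.mul_sum]
    rw [Finset.sum_congr rfl fun i _ => Finset.sum_comm, Finset.sum_comm]
    refine Finset.sum_congr rfl fun y _ => ?_
    split_ifs
    · unfold cfX
      rw [Finset.mul_sum]
      refine Finset.sum_congr rfl fun i _ => ?_
      rw [Finset.mul_sum]
      exact Finset.sum_congr rfl fun j _ => by ring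
    · simp

lemma mixed_density (hd : 0 < d) : IsDensity (((1 / d : ℝ) : ℂ) • (1 : Matrix (Fin d) (Fin d) ℂ)) := by
  have hd' : (d : ℂ) ≠ 0 := by exact_mod_cast hd.ne'
  constructor
  · exact Matrix.PosSemidef.one.smul (by rw [Complex.zero_le_real]; positivity)
  · simp [Matrix.trace_smul, hd']

lemma tau_density (hd : 0 < d) (hρ : IsDensity ρ) (S : Finset (Fin n)) (z : Fin n → Out d)
    (u : Fin n) : IsDensity (tau ρ S z u) := by
  by_cases h : u ∈ S ∨ mg (Pr ρ) S z = 0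
  · unfold tau; rw [if_pos h]; exact mixed_density hd
  · push Not at h
    obtain ⟨hu, h0⟩ := h
    have h0' : (mg (Pr ρ) S z : ℂ) ≠ 0 := by exact_mod_cast h0
    have hpos : 0 < mg (Pr ρ) S z := lt_of_le_of_ne (mg_nonneg (Pr_nonneg hρ) S z) h0.symm
    have hform : ∀ X, (X * tau ρ S z u).trace =
        (prodState (fam S z u X) * ρ).trace / (mg (Pr ρ) S z : ℂ) := by
      intro X
      rw [tau_trace hd hρ S z u hu X, mul_div_cancel_left₀ _ h0']
    have hherm : (tau ρ S z u).IsHermitian := by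
      have hX : ∀ X : Matrix (Fin d) (Fin d) ℂ, (X.conjTranspose * tau ρ S z u).trace =
          star (X * tau ρ S z u).trace := by
        intro X
        rw [hform, hform]
        have : fam S z u X.conjTranspose = fun v => (fam S z u X v).conjTranspose := by
          funext v
          unfold fam
          split_ifs
          · rfl
          · exact (Mx_psd _).isHermitian.eq.symm
          · simp
        rw [this, prodState_conjTranspose, star_div₀, ← Matrix.trace_conjTranspose,
          Matrix.conjTranspose_mul, hρ.1.isHermitian.eq, Matrix.trace_mul_comm]
        simp
      ext i j
      have := hX (Matrix.single i j 1)
      simp [Matrix.trace_single_mul, Matrix.conjTranspose_single] at this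
      simp [Matrix.conjTranspose_apply, this]
    refine ⟨Matrix.PosSemidef.of_dotProduct_mulVec_nonneg hherm fun v => ?_, ?_⟩
    · have e : star v ⬝ᵥ (tau ρ S z u).mulVec v =
          (Matrix.vecMulVec v (star v) * tau ρ S z u).trace := by
        rw [Matrix.trace_mul_comm, Matrix.mul_vecMulVec, Matrix.trace_vecMulVec, dotProduct_comm]
      rw [e, hform]
      have : 0 ≤ (prodState (fam S z u (Matrix.vecMulVec v (star v))) * ρ).trace := by
        refine trace_mul_nonneg (prodState_posSemidef fun w => ?_) hρ.1
        unfold fam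
        split_ifs
        · exact Matrix.posSemidef_vecMulVec_self_star v
        · exact Mx_psd _
        · exact Matrix.PosSemidef.one
      rw [div_eq_mul_inv]
      refine mul_nonneg this ?_
      rw [← Complex.ofReal_inv, Complex.zero_le_real]
      positivity
    · have h1 := hform 1
      rw [Matrix.one_mul] at h1
      rw [h1]
      have h2 := trace_fam hd hρ S z u hu (fun _ => 1)
      simp only [one_smul, Mx_sum hd, mul_one] at h2
      rw [h2]
      have : (mg (Pr ρ) S z : ℂ) = ∑ y, if Agree S z y then (Pr ρ y : ℂ) else 0 := by
        unfold mg
        push_cast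
        exact Finset.sum_congr rfl fun y _ => by split_ifs <;> simp
      rw [← this, div_self h0']

end Tau

/-! ### Entropy of the conditional product states -/

section Ent

variable {n d : ℕ} {ρ : Matrix (Fin n → Fin d) (Fin n → Fin d) ℂ}

lemma tau_spec (hd : 0 < d) (hρ : IsDensity ρ) (S : Finset (Fin n)) (z : Fin n → Out d)
    (u : Fin n) : ∃ (U : Matrix (Fin d) (Fin d) ℂ) (l : Fin d → ℝ),
      U.conjTranspose * U = 1 ∧ U * U.conjTranspose = 1 ∧ (∀ j, 0 ≤ l j) ∧ ∑ j, l j = 1 ∧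
      tau ρ S z u = U * Matrix.diagonal (fun j => (l j : ℂ)) * U.conjTranspose ∧
      (u ∈ S → ∀ j, l j = 1 / d) := by
  have hd' : (d : ℝ) ≠ 0 := by exact_mod_cast hd.ne'
  by_cases hu : u ∈ S
  · refine ⟨1, fun _ => 1 / d, by simp, by simp, fun _ => by positivity, ?_, ?_, fun _ _ => rfl⟩
    · simp [hd']
    · unfold tau
      rw [if_pos (Or.inl hu)]
      simp [Matrix.smul_one_eq_diagonal]
  · have hτ := tau_density hd hρ S z u
    obtain ⟨U, h1, h2, h3⟩ := herm_spec hτ.1.isHermitian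
    refine ⟨U, hτ.1.isHermitian.eigenvalues, h1, h2, fun j => hτ.1.eigenvalues_nonneg j, ?_, h3,
      fun h => absurd h hu⟩
    have ht := hτ.2
    rw [h3, Matrix.mul_assoc, Matrix.trace_mul_comm, Matrix.mul_assoc, h1, Matrix.mul_one,
      Matrix.trace_diagonal] at ht
    exact_mod_cast ht

lemma entropy_prodState (σ : Fin n → Matrix (Fin d) (Fin d) ℂ)
    (U : Fin n → Matrix (Fin d) (Fin d) ℂ) (l : Fin n → Fin d → ℝ)
    (h1 : ∀ u, (U u).conjTranspose * U u = 1) (hl : ∀ u, ∑ j, l u j = 1)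
    (h : ∀ u, σ u = U u * Matrix.diagonal (fun j => (l u j : ℂ)) * (U u).conjTranspose) :
    entropy (prodState σ) = ∑ u, -∑ j, l u j * Real.log (l u j) := by
  have e : prodState σ = prodState U *
      Matrix.diagonal (fun x : Fin n → Fin d => ((∏ u, l u (x u) : ℝ) : ℂ)) *
      (prodState U).conjTranspose := by
    have : σ = fun u => U u * Matrix.diagonal (fun j => (l u j : ℂ)) * (U u).conjTranspose :=
      funext h
    rw [this, prodState_mul, prodState_mul, prodState_conjTranspose,
      prodState_diagonal (fun u j => (l u j : ℂ))]
    push_cast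
    rfl
  have hU : (prodState U).conjTranspose * prodState U = 1 := by
    rw [← prodState_conjTranspose, ← prodState_mul]
    simp only [h1, prodState_one]
  rw [e, entropy_of_conj _ hU, Finset.sum_neg_distrib]
  congr 1
  have h2 : ∀ x : Fin n → Fin d, (∏ u, l u (x u)) * Real.log (∏ u, l u (x u)) =
      ∑ u, (∏ v, l v (x v)) * Real.log (l u (x u)) := by
    intro x
    by_cases h0 : ∃ u, l u (x u) = 0
    · obtain ⟨u, hu⟩ := h0
      have : ∏ v, l v (x v) = 0 := Finset.prod_eq_zero (Finset.mem_univ u) hu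
      simp [this]
    · push Not at h0
      rw [Real.log_prod (fun u _ => h0 u), Finset.mul_sum]
  simp only [h2]
  rw [Finset.sum_comm]
  refine Finset.sum_congr rfl fun u _ => ?_
  have h3 : ∀ x : Fin n → Fin d, (∏ v, l v (x v)) * Real.log (l u (x u)) =
      ∏ v, (l v (x v) * if v = u then Real.log (l v (x v)) else 1) := by
    intro x
    rw [Finset.prod_mul_distrib]
    simp
  simp only [h3]
  have h4 := Finset.prod_univ_sum (fun _ : Fin n => (Finset.univ : Finset (Fin d)))
    (fun v j => l v j * if v = u then Real.log (l v j) else 1)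
  rw [Fintype.piFinset_univ] at h4
  rw [← h4, ← Finset.mul_prod_erase _ _ (Finset.mem_univ u)]
  have h5 : ∏ v ∈ Finset.univ.erase u, ∑ j, (l v j * if v = u then Real.log (l v j) else 1) = 1 := by
    refine Finset.prod_eq_one fun v hv => ?_
    simp [Finset.ne_of_mem_erase hv, hl]
  rw [h5]
  simp

lemma trace_N (hd : 0 < d) (hρ : IsDensity ρ) (S : Finset (Fin n)) (z : Fin n → Out d) :
    (prodState (fun v => if v ∈ S then Mx (z v) else 1) * ρ).trace = (mg (Pr ρ) S z : ℂ) := by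
  have e : (fun v => if v ∈ S then Mx (z v) else 1) = fun v => ∑ a, (
      if v ∈ S then (if a = z v then (1 : ℂ) else 0) else 1) • Mx a := by
    funext v
    split_ifs
    · simp
    · simp [Mx_sum hd]
  rw [e, exp_formula hρ]
  unfold mg
  push_cast
  refine Finset.sum_congr rfl fun y _ => ?_
  have h2 : ∏ v, (if v ∈ S then (if y v = z v then (1 : ℂ) else 0) else 1)
      = if Agree S z y then 1 else 0 := by
    split_ifs with h
    · refine Finset.prod_eq_one fun v hv => ?_
      split_ifs with h1 h2
      · rfl
      · exact absurd (h v h1).symm h2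
      · rfl
    · have : ∃ v ∈ S, z v ≠ y v := by
        by_contra! h'; exact h h'
      obtain ⟨v, hv, hne⟩ := this
      refine Finset.prod_eq_zero (Finset.mem_univ v) ?_
      simp [hv, hne.symm]
  rw [h2]
  split_ifs <;> simp

lemma sum_agree_const (S : Finset (Fin n)) (q : ℝ) (hq : (Fintype.card (Out d) : ℝ) * q = 1)
    (y : Fin n → Out d) :
    ∑ z, (if Agree S z y then ∏ v, (if v ∈ S then (1 : ℝ) else q) else 0) = 1 := by
  have h1 : ∀ z : Fin n → Out d, (if Agree S z y then ∏ v, (if v ∈ S then (1 : ℝ) else q) else 0) =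
      ∏ v, (if v ∈ S then (if z v = y v then 1 else 0) else q) := by
    intro z
    split_ifs with h
    · refine Finset.prod_congr rfl fun v _ => ?_
      split_ifs with h1 h2
      · rfl
      · exact absurd (h v h1) h2
      · rfl
    · have : ∃ v ∈ S, z v ≠ y v := by
        by_contra! h'; exact h h'
      obtain ⟨v, hv, hne⟩ := this
      refine (Finset.prod_eq_zero (Finset.mem_univ v) ?_).symm
      simp [hv, hne]
  simp only [h1]
  have h4 := Finset.prod_univ_sum (fun _ : Fin n => (Finset.univ : Finset (Out d)))
    (fun v a => if v ∈ S then (if a = y v then (1 : ℝ) else 0) else q)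
  rw [Fintype.piFinset_univ] at h4
  rw [← h4]
  refine Finset.prod_eq_one fun v _ => ?_
  split_ifs
  · simp
  · rw [Finset.sum_const, nsmul_eq_mul, Finset.card_univ, hq]

lemma sum_kappa (S : Finset (Fin n)) (q : ℝ) (hq : (Fintype.card (Out d) : ℝ) * q = 1)
    (P : (Fin n → Out d) → ℝ) (g : (Fin n → Out d) → ℝ) (hg : Dep S g) :
    ∑ z, (∏ v, (if v ∈ S then (1 : ℝ) else q)) * mg P S z * g z = ∑ z, P z * g z := by
  unfold mg
  simp only [Finset.mul_sum, Finset.sum_mul]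
  rw [Finset.sum_comm]
  refine Finset.sum_congr rfl fun y _ => ?_
  have h1 : ∀ z, (∏ v, (if v ∈ S then (1 : ℝ) else q)) * (if Agree S z y then P y else 0) * g z =
      (if Agree S z y then ∏ v, (if v ∈ S then (1 : ℝ) else q) else 0) * (P y * g y) := by
    intro z
    split_ifs with h
    · rw [hg z y h]; ring
    · ring
  simp only [h1]
  rw [← Finset.sum_mul, sum_agree_const S q hq y, one_mul]

theorem entropy_le_avg (hd : 0 < d) (hρ : IsDensity ρ) (S : Finset (Fin n)) :
    entropy ρ ≤ ∑ z, Pr ρ z * entropy (prodState (tau ρ S z)) := by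
  have hdR : (d : ℝ) ≠ 0 := by exact_mod_cast hd.ne'
  have hdC : (d : ℂ) ≠ 0 := by exact_mod_cast hd.ne'
  have hspec := fun z u => tau_spec hd hρ S z u
  choose U l hU1 hU2 hl0 hl1 hτ hlS using hspec
  obtain ⟨q, hq0, hq⟩ : ∃ q : ℝ, 0 ≤ q ∧ (Fintype.card (Out d) : ℝ) * q = 1 := by
    have : Nonempty (Fin d) := ⟨⟨0, hd⟩⟩
    have : (Fintype.card (Out d) : ℝ) ≠ 0 := by exact_mod_cast Fintype.card_ne_zero
    exact ⟨1 / (Fintype.card (Out d) : ℝ), by positivity, by field_simp⟩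
  have hqC : (Fintype.card (Out d) : ℂ) * (q : ℂ) = 1 := by exact_mod_cast hq
  set κ : ℝ := ∏ v : Fin n, (if v ∈ S then (1 : ℝ) else q) with hκ
  let F : (Fin n → Out d) → Fin n → Fin d → Matrix (Fin d) (Fin d) ℂ := fun z u j =>
    if u ∈ S then ((1 / d : ℝ) : ℂ) • Mx (z u)
    else (q : ℂ) • (U z u * Matrix.single j j 1 * (U z u).conjTranspose)
  let N : (Fin n → Out d) → Fin n → Matrix (Fin d) (Fin d) ℂ := fun z u =>
    if u ∈ S then Mx (z u) else (q : ℂ) • 1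
  have hFpsd : ∀ z u j, (F z u j).PosSemidef := by
    intro z u j
    simp only [F]
    split_ifs
    · exact (Mx_psd _).smul (by rw [Complex.zero_le_real]; positivity)
    · refine Matrix.PosSemidef.smul ?_ (by rw [Complex.zero_le_real]; exact hq0)
      refine Matrix.PosSemidef.mul_mul_conjTranspose_same ?_ _
      have : Matrix.single j j (1 : ℂ) = Matrix.diagonal (Pi.single j 1) := by
        rw [Matrix.diagonal_single]
      rw [this]
      refine Matrix.PosSemidef.diagonal fun i => ?_
      by_cases h : i = j
      · subst h; simp
      · simp [h]
  have hFN : ∀ z u, ∑ j, F z u j = N z u := by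
    intro z u
    simp only [F, N]
    split_ifs
    · rw [Finset.sum_const, Finset.card_univ, Fintype.card_fin, ← Nat.cast_smul_eq_nsmul ℂ,
        smul_smul]
      have : (d : ℂ) * ((1 / d : ℝ) : ℂ) = 1 := by push_cast; field_simp
      rw [this, one_smul]
    · rw [← Finset.smul_sum, ← Finset.sum_mul, ← Finset.mul_sum]
      have : ∑ j : Fin d, Matrix.single j j (1 : ℂ) = 1 := by
        simp only [← Matrix.diagonal_single]
        ext a b
        rw [Matrix.sum_apply]
        by_cases h : a = b
        · subst h; simp [Pi.single_apply]
        · simp [Matrix.diagonal_apply_ne _ h, h]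
      rw [this, Matrix.mul_one, hU2]
  let t : (Fin n → Out d) → Fin n → ℝ := fun z u =>
    if u ∈ S then 1 / d * (Mx (z u)).trace.re else q
  have htr : ∀ z u j, (F z u j).trace = (t z u : ℂ) := by
    intro z u j
    simp only [F, t]
    split_ifs
    · have h := (Mx_psd (z u)).trace_nonneg
      rw [Complex.le_def] at h
      have : (Mx (z u)).trace = ((Mx (z u)).trace.re : ℂ) :=
        Complex.ext (by simp) (by simpa using h.2.symm)
      rw [Matrix.trace_smul, this, smul_eq_mul]
      push_cast
      simp
    · rw [Matrix.trace_smul, Matrix.mul_assoc, Matrix.trace_mul_comm, Matrix.mul_assoc, hU1,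
        Matrix.mul_one, Matrix.trace_single_eq_same, smul_eq_mul, mul_one]
  have htsum : ∑ z, ∏ u, t z u = 1 := by
    have h4 := Finset.prod_univ_sum (fun _ : Fin n => (Finset.univ : Finset (Out d)))
      (fun u a => if u ∈ S then 1 / (d : ℝ) * (Mx a).trace.re else q)
    rw [Fintype.piFinset_univ] at h4
    simp only [t]
    rw [← h4]
    refine Finset.prod_eq_one fun v _ => ?_
    split_ifs
    · rw [← Finset.mul_sum, ← Complex.re_sum, ← Matrix.trace_sum, Mx_sum hd]
      simp [hdR]
    · rw [Finset.sum_const, nsmul_eq_mul, Finset.card_univ, hq]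
  have hNtr : ∀ z, (prodState (N z) * ρ).trace = (κ : ℂ) * mg (Pr ρ) S z := by
    intro z
    have e : N z = fun v => (if v ∈ S then (1 : ℂ) else q) • (if v ∈ S then Mx (z v) else 1) := by
      funext v
      simp only [N]
      split_ifs <;> simp
    rw [e, prodState_smul, Matrix.smul_mul, Matrix.trace_smul, trace_N hd hρ, smul_eq_mul, hκ]
    congr 1
    push_cast
    exact Finset.prod_congr rfl fun v _ => by split_ifs <;> simp
  have hW : ∀ z u j, (prodState (Function.update (N z) u (F z u j)) * ρ).trace =
      ((κ * mg (Pr ρ) S z * l z u j : ℝ) : ℂ) := by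
    intro z u j
    by_cases hu : u ∈ S
    · have e : Function.update (N z) u (F z u j) =
          fun v => (if v = u then ((1 / d : ℝ) : ℂ) else 1) • N z v := by
        funext v
        by_cases hv : v = u
        · subst hv; simp [F, N, hu]
        · simp [Function.update_of_ne hv, hv]
      rw [e, prodState_smul, Matrix.smul_mul, Matrix.trace_smul, hNtr, smul_eq_mul, hlS z u hu]
      simp
      ring
    · have e : Function.update (N z) u (F z u j) = fun v => (if v ∈ S then (1 : ℂ) else q) •
          fam S z u (U z u * Matrix.single j j 1 * (U z u).conjTranspose) v := by
        funext v
        by_cases hv : v = u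
        · subst hv; simp [F, fam, hu]
        · rw [Function.update_of_ne hv]
          simp only [N, fam, if_neg hv]
          split_ifs <;> simp
      rw [e, prodState_smul, Matrix.smul_mul, Matrix.trace_smul, tau_trace hd hρ S z u hu,
        smul_eq_mul, hτ]
      have e2 : (U z u * Matrix.single j j 1 * (U z u).conjTranspose *
          (U z u * Matrix.diagonal (fun j => (l z u j : ℂ)) * (U z u).conjTranspose)).trace =
          (l z u j : ℂ) := by
        have : U z u * Matrix.single j j 1 * (U z u).conjTranspose *
          (U z u * Matrix.diagonal (fun j => (l z u j : ℂ)) * (U z u).conjTranspose) =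
          U z u * (Matrix.single j j 1 * ((U z u).conjTranspose * U z u) *
            Matrix.diagonal (fun j => (l z u j : ℂ))) * (U z u).conjTranspose := by
          simp only [Matrix.mul_assoc]
        rw [this, hU1, Matrix.mul_assoc, Matrix.trace_mul_comm, Matrix.mul_assoc, hU1]
        simp [Matrix.trace_single_mul]
      rw [e2, hκ]
      push_cast
      rw [mul_assoc]
      congr 1
      exact Finset.prod_congr rfl fun v _ => by split_ifs <;> simp
  let T : (Fin n → Out d) → (Fin n → Fin d) → ℝ := fun z j =>
    (prodState (fun v => F z v (j v)) * ρ).trace.re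
  have hT0 : ∀ z j, 0 ≤ T z j := fun z j =>
    (Complex.le_def.mp (trace_mul_nonneg (prodState_posSemidef fun u => hFpsd z u (j u)) hρ.1)).1
  have hmark : ∀ z u (f : Fin d → ℝ), ∑ j, f (j u) * T z j =
      ∑ a, f a * (κ * mg (Pr ρ) S z * l z u a) := by
    intro z u f
    have h := sum_prodState_marked (F z) u (fun a => (f a : ℂ))
    have h2 := congrArg (fun X => (X * ρ).trace.re) h
    simp only [Finset.sum_mul, Matrix.trace_sum, Complex.re_sum, Matrix.smul_mul,
      Matrix.trace_smul, smul_eq_mul, Complex.re_ofReal_mul] at h2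
    have e : (fun v => ∑ b, F z v b) = N z := funext fun v => hFN z v
    rw [e] at h2
    simp only [hW, Complex.ofReal_re] at h2
    exact h2
  have hzero : ∀ z j, ∏ u, l z u (j u) = 0 → T z j = 0 := by
    intro z j h
    obtain ⟨u, -, hu⟩ := Finset.prod_eq_zero_iff.mp h
    have h1 := hmark z u (fun a => if a = j u then 1 else 0)
    simp only [ite_mul, one_mul, zero_mul, Finset.sum_ite_eq', Finset.mem_univ, if_true, hu,
      mul_zero] at h1
    have h2 := Finset.single_le_sum (f := fun j' : Fin n → Fin d => if j' u = j u then T z j' else 0)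
      (fun j' _ => by split_ifs <;> simp [hT0]) (Finset.mem_univ j)
    simp only [if_true] at h2
    rw [h1] at h2
    exact le_antisymm h2 (hT0 z j)
  have main := entropy_le_of_povm (ι := (Fin n → Out d) × (Fin n → Fin d)) ρ hρ
    (fun i => prodState (fun v => F i.1 v (i.2 v)))
    (fun i => prodState_posSemidef fun u => hFpsd i.1 u (i.2 u))
    (by
      rw [Fintype.sum_prod_type]
      simp only
      have : ∀ z, ∑ j : Fin n → Fin d, prodState (fun v => F z v (j v)) = prodState (N z) := by
        intro z
        rw [← prodState_sum]
        simp only [hFN]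
      simp only [this]
      have h := prodState_sum (n := n) (d := d)
        (fun u (a : Out d) => if u ∈ S then Mx a else (q : ℂ) • 1)
      simp only [N]
      rw [← h, ← prodState_one]
      congr 1
      funext u
      split_ifs
      · exact Mx_sum hd
      · rw [Finset.sum_const, Finset.card_univ, ← Nat.cast_smul_eq_nsmul ℂ, smul_smul, hqC,
          one_smul])
    (fun i => ∏ u, l i.1 u (i.2 u))
    (fun i => Finset.prod_nonneg fun u _ => hl0 i.1 u (i.2 u))
    (by
      rw [Fintype.sum_prod_type]
      simp only [trace_prodState, htr]
      refine le_of_eq ?_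
      rw [← htsum]
      refine Finset.sum_congr rfl fun z _ => ?_
      have : (∏ u, (t z u : ℂ)).re = ∏ u, t z u := by
        rw [← Complex.ofReal_prod, Complex.ofReal_re]
      rw [this, ← Finset.mul_sum]
      have h4 := Finset.prod_univ_sum (fun _ : Fin n => (Finset.univ : Finset (Fin d)))
        (fun u a => l z u a)
      rw [Fintype.piFinset_univ] at h4
      rw [← h4]
      simp [hl1])
    (fun i h => hzero i.1 i.2 h)
  refine main.trans (le_of_eq ?_)
  have hdep : Dep S (fun z => entropy (prodState (tau ρ S z))) := fun x y h => by
    simp only [tau_dep ρ S x y h]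
  rw [← sum_kappa S q hq (Pr ρ) _ hdep, Fintype.sum_prod_type, ← Finset.sum_neg_distrib]
  refine Finset.sum_congr rfl fun z _ => ?_
  rw [entropy_prodState (tau ρ S z) (U z) (l z) (hU1 z) (hl1 z) (hτ z)]
  have h1 : ∀ j : Fin n → Fin d, (prodState (fun v => F z v (j v)) * ρ).trace.re *
      Real.log (∏ u, l z u (j u)) = ∑ u, Real.log (l z u (j u)) * T z j := by
    intro j
    change T z j * _ = _
    by_cases h0 : ∏ u, l z u (j u) = 0
    · simp [hzero z j h0]
    · rw [Real.log_prod (fun u hu => Finset.prod_ne_zero_iff.mp h0 u hu), Finset.mul_sum]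
      exact Finset.sum_congr rfl fun u _ => mul_comm _ _
  simp only [h1]
  rw [Finset.sum_comm, Finset.mul_sum, ← Finset.sum_neg_distrib]
  refine Finset.sum_congr rfl fun u _ => ?_
  rw [hmark z u (fun a => Real.log (l z u a)), mul_neg, Finset.mul_sum]
  congr 1
  exact Finset.sum_congr rfl fun a _ => by ring

end Ent

/-! ### Energy of the conditional product states -/

lemma density_entry {m : Type*} [Fintype m] [DecidableEq m] {ρ : Matrix m m ℂ} (hρ : IsDensity ρ)
    (i j : m) : ‖ρ i j‖ ≤ 1 := by
  obtain ⟨C, hC⟩ := psd_factor hρ.1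
  have hdiag : ∀ i, ρ i i = ((∑ k, ‖C k i‖ ^ 2 : ℝ) : ℂ) := by
    intro i
    rw [hC, Matrix.mul_apply]
    push_cast
    refine Finset.sum_congr rfl fun k _ => ?_
    rw [Matrix.conjTranspose_apply]
    simpa using Complex.conj_mul' (C k i)
  have htr : ∑ i, ∑ k, ‖C k i‖ ^ 2 = 1 := by
    have := hρ.2
    simp only [Matrix.trace, Matrix.diag_apply, hdiag] at this
    exact_mod_cast this
  have hle : ∀ i, ∑ k, ‖C k i‖ ^ 2 ≤ 1 := by
    intro i
    rw [← htr]
    exact Finset.single_le_sum (f := fun i => ∑ k, ‖C k i‖ ^ 2)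
      (fun i _ => Finset.sum_nonneg fun k _ => by positivity) (Finset.mem_univ i)
  rw [hC, Matrix.mul_apply]
  refine (norm_sum_le _ _).trans ?_
  calc ∑ k, ‖C.conjTranspose i k * C k j‖ ≤ ∑ k, (‖C k i‖ ^ 2 + ‖C k j‖ ^ 2) / 2 := by
        refine Finset.sum_le_sum fun k _ => ?_
        rw [norm_mul, Matrix.conjTranspose_apply, norm_star]
        nlinarith [sq_nonneg (‖C k i‖ - ‖C k j‖)]
    _ = ((∑ k, ‖C k i‖ ^ 2) + ∑ k, ‖C k j‖ ^ 2) / 2 := by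
        rw [← Finset.sum_div, Finset.sum_add_distrib]
    _ ≤ 1 := by linarith [hle i, hle j]

lemma entry_le_opNorm {m : Type*} [Fintype m] [DecidableEq m] (A : Matrix m m ℂ) (x y : m) :
    ‖A x y‖ ≤ opNorm A := by
  have h1 : A x y = (Matrix.toEuclideanCLM (𝕜 := ℂ) A (EuclideanSpace.single y 1)) x := by
    simp [Matrix.ofLp_toEuclideanCLM]
  rw [h1]
  refine (PiLp.norm_apply_le _ x).trans ?_
  refine ((Matrix.toEuclideanCLM (𝕜 := ℂ) A).le_opNorm _).trans ?_
  simp [opNorm]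

section Energy

variable {n d : ℕ} {ρ : Matrix (Fin n → Fin d) (Fin n → Fin d) ℂ}

/-- single-site factor of a local matrix unit -/
def site (e : Finset (Fin n)) (p q : {u // u ∈ e} → Fin d) (v : Fin n) :
    Matrix (Fin d) (Fin d) ℂ :=
  if h : v ∈ e then Matrix.single (p ⟨v, h⟩) (q ⟨v, h⟩) 1 else 1

/-- classical function of a local matrix unit -/
def sf (e : Finset (Fin n)) (p q : {u // u ∈ e} → Fin d) (v : Fin n) (a : Out d) : ℂ :=
  if h : v ∈ e then cf (p ⟨v, h⟩) (q ⟨v, h⟩) a else 1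

lemma site_apply (e : Finset (Fin n)) (p q : {u // u ∈ e} → Fin d) (x y : Fin n → Fin d) :
    prodState (site e p q) x y =
      if (∀ u ∉ e, x u = y u) ∧ p = (fun u => x u.1) ∧ q = (fun u => y u.1) then 1 else 0 := by
  unfold prodState
  split_ifs with h
  · obtain ⟨h1, h2, h3⟩ := h
    refine Finset.prod_eq_one fun v _ => ?_
    unfold site
    split_ifs with hv
    · rw [h2, h3]; simp
    · rw [h1 v hv]; simp
  · by_cases h1 : ∀ u ∉ e, x u = y u
    · have h2 : ∃ u : {u // u ∈ e}, p u ≠ x u.1 ∨ q u ≠ y u.1 := by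
        by_contra! h'
        exact h ⟨h1, funext fun u => (h' u).1, funext fun u => (h' u).2⟩
      obtain ⟨⟨u, hu⟩, h3⟩ := h2
      refine Finset.prod_eq_zero (Finset.mem_univ u) ?_
      unfold site
      rw [dif_pos hu, Matrix.single_apply, if_neg]
      rintro ⟨ha, hb⟩
      rcases h3 with h3 | h3
      · exact h3 ha
      · exact h3 hb
    · push Not at h1
      obtain ⟨u, hu, hne⟩ := h1
      refine Finset.prod_eq_zero (Finset.mem_univ u) ?_
      unfold site
      rw [dif_neg hu, Matrix.one_apply_ne hne]

lemma local_expand {A : Matrix (Fin n → Fin d) (Fin n → Fin d) ℂ} {e : Finset (Fin n)}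
    (M : Matrix ({u // u ∈ e} → Fin d) ({u // u ∈ e} → Fin d) ℂ)
    (hM : ∀ x y, A x y = (if ∀ u ∉ e, x u = y u then (1 : ℂ) else 0) *
        M (fun u => x u.1) (fun u => y u.1)) :
    A = ∑ p, ∑ q, M p q • prodState (site e p q) := by
  ext x y
  rw [hM]
  simp only [Matrix.sum_apply, Matrix.smul_apply, site_apply, smul_eq_mul]
  by_cases h : ∀ u ∉ e, x u = y u
  · rw [if_pos h, Finset.sum_eq_single (fun u => x u.1)]
    · rw [Finset.sum_eq_single (fun u => y u.1)]
      · rw [if_pos ⟨h, rfl, rfl⟩]; ring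
      · intro q _ hq
        rw [if_neg (by tauto)]; ring
      · simp
    · intro p _ hp
      refine Finset.sum_eq_zero fun q _ => ?_
      rw [if_neg (by tauto)]; ring
    · simp
  · rw [if_neg h, zero_mul]
    refine (Finset.sum_eq_zero fun p _ => Finset.sum_eq_zero fun q _ => ?_).symm
    rw [if_neg (by tauto)]; ring

lemma local_entry (hd : 0 < d) {A : Matrix (Fin n → Fin d) (Fin n → Fin d) ℂ}
    {e : Finset (Fin n)}
    (M : Matrix ({u // u ∈ e} → Fin d) ({u // u ∈ e} → Fin d) ℂ)
    (hM : ∀ x y, A x y = (if ∀ u ∉ e, x u = y u then (1 : ℂ) else 0) *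
        M (fun u => x u.1) (fun u => y u.1)) (hA : opNorm A ≤ 1) (p q) : ‖M p q‖ ≤ 1 := by
  let X : ({u // u ∈ e} → Fin d) → Fin n → Fin d := fun p v =>
    if h : v ∈ e then p ⟨v, h⟩ else ⟨0, hd⟩
  have h := hM (X p) (X q)
  have hX : ∀ p, (fun u : {u // u ∈ e} => X p u.1) = p := by
    intro p; funext u; simp [X]
  rw [hX, hX, if_pos (by intro u hu; simp [X, hu]), one_mul] at h
  rw [← h]
  exact (entry_le_opNorm A _ _).trans hA

lemma trace_site (hd : 0 < d) (hρ : IsDensity ρ) (e : Finset (Fin n))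
    (p q : {u // u ∈ e} → Fin d) :
    (prodState (site e p q) * ρ).trace = ∑ x, (Pr ρ x : ℂ) * ∏ u ∈ e, sf e p q u (x u) := by
  have h : site e p q = fun v => ∑ a, sf e p q v a • Mx a := by
    funext v
    unfold site sf
    split_ifs
    · exact unit_expand hd _ _
    · simp [Mx_sum hd]
  rw [h, exp_formula hρ]
  refine Finset.sum_congr rfl fun x _ => ?_
  congr 1
  refine (Finset.prod_subset (Finset.subset_univ e) fun v _ hv => ?_).symm
  simp [sf, hv]

lemma trace_site_prod {σ : Fin n → Matrix (Fin d) (Fin d) ℂ} (hσ : ∀ u, IsDensity (σ u))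
    (e : Finset (Fin n)) (p q : {u // u ∈ e} → Fin d) :
    (prodState (site e p q) * prodState σ).trace = ∏ u ∈ e, (site e p q u * σ u).trace := by
  rw [← prodState_mul, trace_prodState]
  refine (Finset.prod_subset (Finset.subset_univ e) fun v _ hv => ?_).symm
  simp [site, hv, (hσ v).2]

lemma norm_sf_le (hd : 0 < d) (e : Finset (Fin n)) (p q : {u // u ∈ e} → Fin d) (u : Fin n)
    (a : Out d) : ‖sf e p q u a‖ ≤ 2 * d := by
  unfold sf
  split_ifs
  · exact norm_cf_le _ _ _
  · have : (1 : ℝ) ≤ d := by exact_mod_cast hd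
    simp; linarith

lemma trace_site_tau {S e : Finset (Fin n)} (hdis : Disjoint e S) {z : Fin n → Out d}
    (h0 : mg (Pr ρ) S z ≠ 0) (p q : {u // u ∈ e} → Fin d) (u : Fin n) (hu : u ∈ e) :
    (site e p q u * tau ρ S z u).trace = ce (Pr ρ) S (fun y => sf e p q u (y u)) z := by
  have huS : u ∉ S := Finset.disjoint_left.mp hdis hu
  unfold site tau sf
  rw [if_neg (by tauto)]
  simp only [dif_pos hu]
  simp [Matrix.trace_single_mul]

/-- the information potential -/
def Phi (ρ : Matrix (Fin n → Fin d) (Fin n → Fin d) ℂ) (u : Fin n) (S : Finset (Fin n)) : ℝ :=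
  ∑ i : Fin d, ∑ j : Fin d, phi (Pr ρ) (fun y => cf i j (y u)) S

lemma Phi_nonneg (hρ : IsDensity ρ) (u : Fin n) (S : Finset (Fin n)) : 0 ≤ Phi ρ u S :=
  Finset.sum_nonneg fun _ _ => Finset.sum_nonneg fun _ _ => phi_nonneg (Pr_nonneg hρ) _ _

lemma Phi_mono (hρ : IsDensity ρ) (u : Fin n) (S T : Finset (Fin n)) (h : S ⊆ T) :
    Phi ρ u S ≤ Phi ρ u T :=
  Finset.sum_le_sum fun _ _ => Finset.sum_le_sum fun _ _ => phi_mono (Pr_nonneg hρ) _ h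

lemma Phi_le (hd : 0 < d) (hρ : IsDensity ρ) (u : Fin n) (S : Finset (Fin n)) :
    Phi ρ u S ≤ d * (d * (2 * d) ^ 2) := by
  unfold Phi
  calc _ ≤ ∑ i : Fin d, ∑ j : Fin d, (2 * d : ℝ) ^ 2 :=
        Finset.sum_le_sum fun i _ => Finset.sum_le_sum fun j _ =>
          phi_le (Pr_nonneg hρ) (Pr_sum hd hρ) S _ (by positivity) fun x => norm_cf_le _ _ _
    _ = _ := by simp

lemma phi_sf_le (hρ : IsDensity ρ) (e : Finset (Fin n)) (p q : {u // u ∈ e} → Fin d) (u : Fin n)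
    (hu : u ∈ e) {S T : Finset (Fin n)} (h : S ⊆ T) :
    phi (Pr ρ) (fun y => sf e p q u (y u)) T - phi (Pr ρ) (fun y => sf e p q u (y u)) S ≤
      Phi ρ u T - Phi ρ u S := by
  unfold Phi sf
  simp only [dif_pos hu]
  rw [← Finset.sum_sub_distrib]
  simp only [← Finset.sum_sub_distrib]
  have hn : ∀ i j : Fin d, 0 ≤ phi (Pr ρ) (fun y => cf i j (y u)) T -
      phi (Pr ρ) (fun y => cf i j (y u)) S := fun i j =>
    sub_nonneg.mpr (phi_mono (Pr_nonneg hρ) _ h)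
  refine le_trans ?_ (Finset.single_le_sum (f := fun i => ∑ j, (phi (Pr ρ) (fun y => cf i j (y u)) T -
      phi (Pr ρ) (fun y => cf i j (y u)) S)) (fun i _ => Finset.sum_nonneg fun j _ => hn i j)
      (Finset.mem_univ (p ⟨u, hu⟩)))
  exact Finset.single_le_sum (f := fun j => (phi (Pr ρ) (fun y => cf (p ⟨u, hu⟩) j (y u)) T -
      phi (Pr ρ) (fun y => cf (p ⟨u, hu⟩) j (y u)) S)) (fun j _ => hn _ j)
      (Finset.mem_univ (q ⟨u, hu⟩))

lemma unit_bound (hd : 0 < d) (hρ : IsDensity ρ) (S e : Finset (Fin n))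
    (p q : {u // u ∈ e} → Fin d) {ε : ℝ} (hε : 0 < ε) :
    ‖(prodState (site e p q) * ρ).trace -
      ∑ z, (Pr ρ z : ℂ) * (prodState (site e p q) * prodState (tau ρ S z)).trace‖ ≤
    (1 + (2 * d : ℝ) ^ e.card) * (if Disjoint e S then 0 else 1) +
      (2 * d : ℝ) ^ e.card * ∑ u ∈ e, (ε + (Phi ρ u (S ∪ e.erase u) - Phi ρ u S) / ε) := by
  have hP := Pr_nonneg hρ
  have hB : (1 : ℝ) ≤ 2 * d := by
    have : (1 : ℝ) ≤ d := by exact_mod_cast hd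
    linarith
  have hτ := tau_density hd hρ S
  have hsum : 0 ≤ (2 * d : ℝ) ^ e.card *
      ∑ u ∈ e, (ε + (Phi ρ u (S ∪ e.erase u) - Phi ρ u S) / ε) := by
    refine mul_nonneg (by positivity) (Finset.sum_nonneg fun u _ => ?_)
    have := Phi_mono hρ u S (S ∪ e.erase u) Finset.subset_union_left
    have : 0 ≤ (Phi ρ u (S ∪ e.erase u) - Phi ρ u S) / ε := div_nonneg (by linarith) hε.le
    linarith
  rw [trace_site hd hρ]
  by_cases hdis : Disjoint e S
  · rw [if_pos hdis, mul_zero, zero_add]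
    have e1 : ∀ z, (Pr ρ z : ℂ) * (prodState (site e p q) * prodState (tau ρ S z)).trace =
        (Pr ρ z : ℂ) * ∏ u ∈ e, ce (Pr ρ) S (fun y => sf e p q u (y u)) z := by
      intro z
      by_cases h0 : mg (Pr ρ) S z = 0
      · have : Pr ρ z = 0 := le_antisymm (h0 ▸ le_mg hP S z) (hP z)
        simp [this]
      · rw [trace_site_prod (hτ z)]
        congr 1
        exact Finset.prod_congr rfl fun u hu => trace_site_tau hdis h0 p q u hu
    simp only [e1]
    refine (hybrid hP (Pr_sum hd hρ) S e (sf e p q) hB (norm_sf_le hd e p q) hε).trans ?_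
    rw [Finset.mul_sum]
    refine Finset.sum_le_sum fun u hu => mul_le_mul_of_nonneg_left ?_ (by positivity)
    have := phi_sf_le hρ e p q u hu (S := S) (T := S ∪ e.erase u) Finset.subset_union_left
    gcongr
  · rw [if_neg hdis, mul_one]
    refine le_trans ?_ (le_add_of_nonneg_right hsum)
    refine (norm_sub_le _ _).trans ?_
    rw [add_comm]
    refine add_le_add ?_ ?_
    · refine (norm_sum_le _ _).trans ?_
      rw [← Pr_sum hd hρ]
      refine Finset.sum_le_sum fun z _ => ?_
      rw [norm_mul, Complex.norm_real, Real.norm_of_nonneg (hP z)]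
      refine mul_le_of_le_one_right (hP z) ?_
      rw [trace_site_prod (hτ z), norm_prod]
      refine Finset.prod_le_one (fun _ _ => norm_nonneg _) fun u hu => ?_
      unfold site
      rw [dif_pos hu]
      simpa [Matrix.trace_single_mul] using density_entry (hτ z u) _ _
    · refine (norm_sum_le _ _).trans ?_
      calc _ ≤ ∑ x, Pr ρ x * (2 * d : ℝ) ^ e.card := by
            refine Finset.sum_le_sum fun z _ => ?_
            rw [norm_mul, Complex.norm_real, Real.norm_of_nonneg (hP z), norm_prod]
            refine mul_le_mul_of_nonneg_left ?_ (hP z)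
            rw [← Finset.prod_const]
            exact Finset.prod_le_prod (fun u _ => norm_nonneg _)
              (fun u _ => norm_sf_le hd e p q u _)
        _ = _ := by rw [← Finset.sum_mul, Pr_sum hd hρ, one_mul]

lemma edge_bound (hd : 0 < d) (hρ : IsDensity ρ) (S e : Finset (Fin n))
    (A : Matrix (Fin n → Fin d) (Fin n → Fin d) ℂ) (hA : ActsOn A e) (hA1 : opNorm A ≤ 1)
    {ε : ℝ} (hε : 0 < ε) :
    |energy A ρ - ∑ z, Pr ρ z * energy A (prodState (tau ρ S z))| ≤
    (d : ℝ) ^ e.card * (d : ℝ) ^ e.card *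
    ((1 + (2 * d : ℝ) ^ e.card) * (if Disjoint e S then 0 else 1) +
      (2 * d : ℝ) ^ e.card * ∑ u ∈ e, (ε + (Phi ρ u (S ∪ e.erase u) - Phi ρ u S) / ε)) := by
  obtain ⟨M, hM⟩ := hA
  have hM1 := local_entry hd M hM hA1
  have hexp := local_expand M hM
  set R := (1 + (2 * d : ℝ) ^ e.card) * (if Disjoint e S then 0 else 1) +
      (2 * d : ℝ) ^ e.card * ∑ u ∈ e, (ε + (Phi ρ u (S ∪ e.erase u) - Phi ρ u S) / ε) with hR
  have e1 : energy A ρ - ∑ z, Pr ρ z * energy A (prodState (tau ρ S z)) =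
      ((A * ρ).trace - ∑ z, (Pr ρ z : ℂ) * (A * prodState (tau ρ S z)).trace).re := by
    simp [energy, Complex.re_sum]
  have e2 : ∀ X, (A * X).trace = ∑ p, ∑ q, M p q * (prodState (site e p q) * X).trace := by
    intro X
    conv_lhs => rw [hexp]
    simp only [Finset.sum_mul, Matrix.trace_sum, Matrix.smul_mul, Matrix.trace_smul, smul_eq_mul]
  rw [e1]
  refine (Complex.abs_re_le_norm _).trans ?_
  have e3 : (A * ρ).trace - ∑ z, (Pr ρ z : ℂ) * (A * prodState (tau ρ S z)).trace =
      ∑ p, ∑ q, M p q * ((prodState (site e p q) * ρ).trace -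
      ∑ z, (Pr ρ z : ℂ) * (prodState (site e p q) * prodState (tau ρ S z)).trace) := by
    simp only [e2, mul_sub, Finset.sum_sub_distrib]
    congr 1
    simp only [Finset.mul_sum]
    rw [Finset.sum_comm]
    refine Finset.sum_congr rfl fun p _ => ?_
    rw [Finset.sum_comm]
    exact Finset.sum_congr rfl fun q _ => Finset.sum_congr rfl fun z _ => by ring
  rw [e3]
  refine (norm_sum_le _ _).trans ?_
  calc _ ≤ ∑ p : {u // u ∈ e} → Fin d, ∑ q : {u // u ∈ e} → Fin d, R := by
        refine Finset.sum_le_sum fun p _ => (norm_sum_le _ _).trans ?_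
        refine Finset.sum_le_sum fun q _ => ?_
        rw [norm_mul]
        exact (mul_le_of_le_one_left (norm_nonneg _) (hM1 p q)).trans
          (unit_bound hd hρ S e p q hε)
    _ = _ := by
        simp [Finset.sum_const, mul_assoc]

theorem energy_bound (hd : 0 < d) (hρ : IsDensity ρ) (S : Finset (Fin n))
    (E : Finset (Finset (Fin n))) (k : ℕ) (hk : ∀ e ∈ E, e.card = k)
    (h : Finset (Fin n) → Matrix (Fin n → Fin d) (Fin n → Fin d) ℂ)
    (hA : ∀ e ∈ E, ActsOn (h e) e) (hA1 : ∀ e ∈ E, opNorm (h e) ≤ 1)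
    {ε : ℝ} (hε : 0 < ε) :
    ∑ z, Pr ρ z * energy (∑ e ∈ E, h e) (prodState (tau ρ S z)) ≤ energy (∑ e ∈ E, h e) ρ +
    ((d : ℝ) ^ k * (d : ℝ) ^ k * (1 + (2 * d : ℝ) ^ k) * touched E S +
     (d : ℝ) ^ k * (d : ℝ) ^ k * (2 * d : ℝ) ^ k *
      ∑ e ∈ E, ∑ u ∈ e, (ε + (Phi ρ u (S ∪ e.erase u) - Phi ρ u S) / ε)) := by
  have e1 : ∀ X, energy (∑ e ∈ E, h e) X = ∑ e ∈ E, energy (h e) X := by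
    intro X
    simp [energy, Finset.sum_mul, Matrix.trace_sum, Complex.re_sum]
  simp only [e1, Finset.mul_sum (s := E), touched]
  rw [Finset.sum_comm, ← Finset.sum_add_distrib, ← Finset.sum_add_distrib]
  refine Finset.sum_le_sum fun e he => ?_
  have := edge_bound hd hρ S e (h e) (hA e he) (hA1 e he) hε
  rw [hk e he] at this
  have h2 := (abs_le.mp this).1
  linarith

end Energy

/-! ### Parameters and conclusion -/

lemma params (n m k : ℕ) (hn : 0 < n) (hm : 0 < m) (hmn : m ≤ n ^ k) :
    ∃ L : ℕ, 0 < L ∧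
      (m : ℝ) * L / n ≤ 2 * ((n : ℝ) ^ (((k : ℝ) - 1) / 3) * (m : ℝ) ^ ((2 : ℝ) / 3)) ∧
      (n : ℝ) ^ k * n / (L ^ 2) ≤ (n : ℝ) ^ (((k : ℝ) - 1) / 3) * (m : ℝ) ^ ((2 : ℝ) / 3) := by
  have hn0 : (0 : ℝ) < n := by exact_mod_cast hn
  have hn1 : (1 : ℝ) ≤ n := by exact_mod_cast hn
  have hm0 : (0 : ℝ) < m := by exact_mod_cast hm
  set T := (n : ℝ) ^ (((k : ℝ) - 1) / 3) * (m : ℝ) ^ ((2 : ℝ) / 3) with hT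
  have hT0 : 0 < T := by positivity
  set x : ℝ := (n : ℝ) ^ (((k : ℝ) + 2) / 3) * (m : ℝ) ^ (-(1 : ℝ) / 3) with hx
  have hx0 : 0 < x := by positivity
  have hx1 : 1 ≤ x := by
    have h1 : (m : ℝ) ^ ((1 : ℝ) / 3) ≤ (n : ℝ) ^ (((k : ℝ) + 2) / 3) := by
      have h2 : (m : ℝ) ≤ (n : ℝ) ^ ((k : ℝ) + 2) := by
        have h3 : (m : ℝ) ≤ (n : ℝ) ^ k := by exact_mod_cast hmn
        refine h3.trans ?_
        rw [← Real.rpow_natCast]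
        exact Real.rpow_le_rpow_of_exponent_le hn1 (by linarith)
      calc (m : ℝ) ^ ((1 : ℝ) / 3) ≤ ((n : ℝ) ^ ((k : ℝ) + 2)) ^ ((1 : ℝ) / 3) :=
            Real.rpow_le_rpow hm0.le h2 (by norm_num)
        _ = _ := by rw [← Real.rpow_mul hn0.le]; congr 1; ring
    have h4 : (m : ℝ) ^ ((1 : ℝ) / 3) * (m : ℝ) ^ (-(1 : ℝ) / 3) = 1 := by
      rw [← Real.rpow_add hm0]; norm_num
    rw [← h4, hx]
    gcongr
  have hmx : (m : ℝ) * x / n = T := by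
    have h1 : (m : ℝ) * (m : ℝ) ^ (-(1 : ℝ) / 3) = (m : ℝ) ^ ((2 : ℝ) / 3) := by
      nth_rewrite 1 [← Real.rpow_one (m : ℝ)]
      rw [← Real.rpow_add hm0]; norm_num
    have h2 : (n : ℝ) ^ (((k : ℝ) + 2) / 3) / n = (n : ℝ) ^ (((k : ℝ) - 1) / 3) := by
      nth_rewrite 2 [← Real.rpow_one (n : ℝ)]
      rw [← Real.rpow_sub hn0]; congr 1; ring
    rw [hT, ← h1, ← h2, hx]; ring
  have hx2 : x ^ 2 * T = (n : ℝ) ^ k * n := by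
    have h1 : ((m : ℝ) ^ (-(1 : ℝ) / 3)) ^ 2 * (m : ℝ) ^ ((2 : ℝ) / 3) = 1 := by
      rw [← Real.rpow_natCast, ← Real.rpow_mul hm0.le, ← Real.rpow_add hm0]; norm_num
    have h2 : ((n : ℝ) ^ (((k : ℝ) + 2) / 3)) ^ 2 * (n : ℝ) ^ (((k : ℝ) - 1) / 3) =
        (n : ℝ) ^ k * n := by
      rw [← pow_succ, ← Real.rpow_natCast, ← Real.rpow_natCast, ← Real.rpow_mul hn0.le,
        ← Real.rpow_add hn0]
      congr 1; push_cast; ring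
    calc x ^ 2 * T = (((n : ℝ) ^ (((k : ℝ) + 2) / 3)) ^ 2 * (n : ℝ) ^ (((k : ℝ) - 1) / 3)) *
          (((m : ℝ) ^ (-(1 : ℝ) / 3)) ^ 2 * (m : ℝ) ^ ((2 : ℝ) / 3)) := by rw [hx, hT]; ring
      _ = _ := by rw [h1, h2, mul_one]
  have hL1 : x ≤ (⌈x⌉₊ : ℝ) := Nat.le_ceil x
  have hL2 : (⌈x⌉₊ : ℝ) ≤ 2 * x := by
    have := (Nat.ceil_lt_add_one hx0.le).le
    linarith
  refine ⟨⌈x⌉₊, Nat.ceil_pos.mpr hx0, ?_, ?_⟩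
  · rw [← hmx]
    calc (m : ℝ) * (⌈x⌉₊ : ℝ) / n ≤ m * (2 * x) / n := by gcongr
      _ = _ := by ring
  · rw [← hx2, div_le_iff₀ (by positivity), mul_comm]
    gcongr

lemma exists_le_avg {ι : Type*} [Fintype ι] (P g : ι → ℝ) (hP : ∀ i, 0 ≤ P i)
    (h1 : ∑ i, P i = 1) : ∃ i, g i ≤ ∑ j, P j * g j := by
  by_contra! h
  have hne : ∃ i, 0 < P i := by
    by_contra! h'
    have : ∑ i, P i ≤ 0 := Finset.sum_nonpos fun i _ => h' i
    linarith
  obtain ⟨i, hi⟩ := hne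
  have : ∑ j, P j * (∑ j, P j * g j) < ∑ j, P j * g j :=
    Finset.sum_lt_sum (fun j _ => mul_le_mul_of_nonneg_left (h j).le (hP j))
      ⟨i, Finset.mem_univ i, mul_lt_mul_of_pos_left (h i) hi⟩
  rw [← Finset.sum_mul, h1, one_mul] at this
  exact lt_irrefl _ this

section Final

variable {n d : ℕ}

/-- the maximally mixed product state -/
def mixed (n d : ℕ) : Fin n → Matrix (Fin d) (Fin d) ℂ := fun _ => ((1 / d : ℝ) : ℂ) • 1

lemma entropy_le_mixed (hd : 0 < d) {ρ : Matrix (Fin n → Fin d) (Fin n → Fin d) ℂ}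
    (hρ : IsDensity ρ) : entropy ρ ≤ entropy (prodState (mixed n d)) := by
  have h := entropy_le_avg hd hρ Finset.univ
  have : ∀ z, tau ρ Finset.univ z = mixed n d := by
    intro z; funext u; simp [tau, mixed]
  simpa only [this, ← Finset.sum_mul, Pr_sum hd hρ, one_mul] using h

lemma energy_lower {m : Type*} [Fintype m] [DecidableEq m] (H : Matrix m m ℂ)
    {ρ : Matrix m m ℂ} (hρ : IsDensity ρ) : -∑ x, ∑ y, ‖H x y‖ ≤ energy H ρ := by
  have h : ‖(H * ρ).trace‖ ≤ ∑ x, ∑ y, ‖H x y‖ := by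
    simp only [Matrix.trace, Matrix.diag_apply, Matrix.mul_apply]
    refine (norm_sum_le _ _).trans (Finset.sum_le_sum fun x _ => (norm_sum_le _ _).trans
      (Finset.sum_le_sum fun y _ => ?_))
    rw [norm_mul]
    exact mul_le_of_le_one_right (norm_nonneg _) (density_entry hρ _ _)
  have := (abs_le.mp ((Complex.abs_re_le_norm (H * ρ).trace).trans h)).1
  exact this

lemma bdd (hd : 0 < d) {β : ℝ} (hβ : 0 < β) (H : Matrix (Fin n → Fin d) (Fin n → Fin d) ℂ) :
    BddBelow {x : ℝ | ∃ ρ, IsDensity ρ ∧ x = freeEnergyFun β H ρ} := by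
  refine ⟨-∑ x, ∑ y, ‖H x y‖ - entropy (prodState (mixed n d)) / β, ?_⟩
  rintro x ⟨ρ, hρ, rfl⟩
  unfold freeEnergyFun
  have h1 := energy_lower H hρ
  have h2 : entropy ρ / β ≤ entropy (prodState (mixed n d)) / β :=
    div_le_div_of_nonneg_right (entropy_le_mixed hd hρ) hβ.le
  linarith

lemma freeEnergy_le (hd : 0 < d) {β : ℝ} (hβ : 0 < β)
    (H : Matrix (Fin n → Fin d) (Fin n → Fin d) ℂ) {ρ : Matrix (Fin n → Fin d) (Fin n → Fin d) ℂ}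
    (hρ : IsDensity ρ) : freeEnergy β H ≤ freeEnergyFun β H ρ :=
  csInf_le (bdd hd hβ H) ⟨ρ, hρ, rfl⟩

lemma set_nonempty (hd : 0 < d) (β : ℝ) (H : Matrix (Fin n → Fin d) (Fin n → Fin d) ℂ) :
    {x : ℝ | ∃ ρ, IsDensity ρ ∧ x = freeEnergyFun β H ρ}.Nonempty :=
  ⟨_, prodState (mixed n d), isDensity_prodState fun _ => mixed_density hd, rfl⟩

lemma product_bound (hd : 0 < d) (k : ℕ) (hk0 : 0 < k) {β : ℝ} (hβ : 0 < β)
    {ρ : Matrix (Fin n → Fin d) (Fin n → Fin d) ℂ} (hρ : IsDensity ρ)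
    (E : Finset (Finset (Fin n))) (hE : 0 < E.card) (hn : 0 < n) (hk : ∀ e ∈ E, e.card = k)
    (h : Finset (Fin n) → Matrix (Fin n → Fin d) (Fin n → Fin d) ℂ)
    (hA : ∀ e ∈ E, ActsOn (h e) e) (hA1 : ∀ e ∈ E, opNorm (h e) ≤ 1)
    (K1 K2 D : ℝ) (hK1 : K1 = (d : ℝ) ^ k * (d : ℝ) ^ k * (1 + (2 * d : ℝ) ^ k))
    (hK2 : K2 = (d : ℝ) ^ k * (d : ℝ) ^ k * (2 * d : ℝ) ^ k)
    (hD : D = d * (d * (2 * d) ^ 2)) :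
    ∃ σ : Fin n → Matrix (Fin d) (Fin d) ℂ, (∀ u, IsDensity (σ u)) ∧
      freeEnergyFun β (∑ e ∈ E, h e) (prodState σ) ≤ freeEnergyFun β (∑ e ∈ E, h e) ρ +
        (2 * (K1 + K2) * k + K2 * k * D) *
          ((n : ℝ) ^ (((k : ℝ) - 1) / 3) * (E.card : ℝ) ^ ((2 : ℝ) / 3)) := by
  have hn0 : (0 : ℝ) < n := by exact_mod_cast hn
  have hmn : E.card ≤ n ^ k := by
    have h1 : E ⊆ Finset.powersetCard k Finset.univ := fun e he => by
      simp [Finset.mem_powersetCard, hk e he]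
    have h2 := Finset.card_le_card h1
    rw [Finset.card_powersetCard, Finset.card_univ, Fintype.card_fin] at h2
    exact h2.trans (Nat.choose_le_pow n k)
  obtain ⟨L, hL, hp1, hp2⟩ := params n E.card k hn hE hmn
  have hL0 : (0 : ℝ) < L := by exact_mod_cast hL
  have hK1' : 0 ≤ K1 := by rw [hK1]; positivity
  have hK2' : 0 ≤ K2 := by rw [hK2]; positivity
  have hD' : 0 ≤ D := by rw [hD]; positivity
  have hε : (0 : ℝ) < L / n := by positivity
  obtain ⟨S, hS⟩ := averaging hn E k hk0 hk (Phi ρ) D (Phi_nonneg hρ)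
    (by rw [hD]; exact Phi_le hd hρ) (Phi_mono hρ) L hL K1 K2 (L / n) hK1' hK2' hε
  have hen := energy_bound hd hρ S E k hk h hA hA1 hε
  rw [← hK1, ← hK2] at hen
  have hent := entropy_le_avg hd hρ S
  obtain ⟨z, hz⟩ := exists_le_avg (Pr ρ)
    (fun z => freeEnergyFun β (∑ e ∈ E, h e) (prodState (tau ρ S z))) (Pr_nonneg hρ)
    (Pr_sum hd hρ)
  refine ⟨tau ρ S z, fun u => tau_density hd hρ S z u, hz.trans ?_⟩
  set T := (n : ℝ) ^ (((k : ℝ) - 1) / 3) * (E.card : ℝ) ^ ((2 : ℝ) / 3) with hT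
  have hsplit : ∑ z, Pr ρ z * freeEnergyFun β (∑ e ∈ E, h e) (prodState (tau ρ S z)) =
      ∑ z, Pr ρ z * energy (∑ e ∈ E, h e) (prodState (tau ρ S z)) -
      (∑ z, Pr ρ z * entropy (prodState (tau ρ S z))) / β := by
    rw [Finset.sum_div, ← Finset.sum_sub_distrib]
    exact Finset.sum_congr rfl fun z _ => by unfold freeEnergyFun; ring
  rw [hsplit]
  have h1 : entropy ρ / β ≤ (∑ z, Pr ρ z * entropy (prodState (tau ρ S z))) / β :=
    div_le_div_of_nonneg_right hent hβ.le
  have h2 : K1 * (L * (k * E.card / n)) + K2 * (k * E.card * (L / n) +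
      k * n ^ k * D / (L / n * L)) ≤ (2 * (K1 + K2) * k + K2 * k * D) * T := by
    have e1 : K1 * (L * (k * E.card / n)) + K2 * (k * E.card * (L / n) +
      k * n ^ k * D / (L / n * L)) = (K1 + K2) * k * ((E.card : ℝ) * L / n) +
        K2 * k * D * ((n : ℝ) ^ k * n / (L ^ 2)) := by
      field_simp
      ring
    rw [e1]
    have a1 : (K1 + K2) * k * ((E.card : ℝ) * L / n) ≤ (K1 + K2) * k * (2 * T) :=
      mul_le_mul_of_nonneg_left hp1 (by positivity)
    have a2 : K2 * k * D * ((n : ℝ) ^ k * n / (L ^ 2)) ≤ K2 * k * D * T :=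
      mul_le_mul_of_nonneg_left hp2 (by positivity)
    linarith
  unfold freeEnergyFun
  linarith

end Final

/-- For all fixed `k` and `d` there is a constant `C` such that for every
inverse temperature `β > 0` and every `k`-local Hamiltonian on `n` qudits of local dimension
`d` with `m` interactions of operator norm at most 1, there is a product mixed state `σ` with
`F(β) ≤ Tr[Hσ] − S(σ)/β ≤ F(β) + C·n^{(k−1)/3}·m^{2/3}`. -/
theorem free_energy_product_state_klocal :
    ∀ k d : ℕ, 0 < k → 0 < d → ∃ C : ℝ, 0 < C ∧
      ∀ (β : ℝ), 0 < β →
      ∀ (n : ℕ) (E : Finset (Finset (Fin n)))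
        (h : Finset (Fin n) → Matrix (Fin n → Fin d) (Fin n → Fin d) ℂ),
        (∀ e ∈ E, e.card = k) →
        (∀ e ∈ E, (h e).IsHermitian) →
        (∀ e ∈ E, ActsOn (h e) e) →
        (∀ e ∈ E, opNorm (h e) ≤ 1) →
        ∃ σ : Fin n → Matrix (Fin d) (Fin d) ℂ,
          (∀ u, IsDensity (σ u)) ∧
          freeEnergy β (∑ e ∈ E, h e) ≤
            freeEnergyFun β (∑ e ∈ E, h e) (prodState σ) ∧
          freeEnergyFun β (∑ e ∈ E, h e) (prodState σ) ≤
            freeEnergy β (∑ e ∈ E, h e) +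
              C * (n : ℝ) ^ (((k : ℝ) - 1) / 3) * (E.card : ℝ) ^ ((2 : ℝ) / 3) := by
  intro k d hk0 hd
  obtain ⟨K1, hK1⟩ : ∃ K1 : ℝ, K1 = (d : ℝ) ^ k * (d : ℝ) ^ k * (1 + (2 * d : ℝ) ^ k) := ⟨_, rfl⟩
  obtain ⟨K2, hK2⟩ : ∃ K2 : ℝ, K2 = (d : ℝ) ^ k * (d : ℝ) ^ k * (2 * d : ℝ) ^ k := ⟨_, rfl⟩
  obtain ⟨D, hD⟩ : ∃ D : ℝ, D = d * (d * (2 * d) ^ 2) := ⟨_, rfl⟩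
  have hK1' : 0 ≤ K1 := by rw [hK1]; positivity
  have hK2' : 0 ≤ K2 := by rw [hK2]; positivity
  have hD' : 0 ≤ D := by rw [hD]; positivity
  refine ⟨2 * (K1 + K2) * k + K2 * k * D + 1, by positivity, ?_⟩
  intro β hβ n E h hk _ hA hA1
  rcases Nat.eq_zero_or_pos E.card with hE | hE
  · have hE' : E = ∅ := Finset.card_eq_zero.mp hE
    subst hE'
    refine ⟨mixed n d, fun _ => mixed_density hd,
      freeEnergy_le hd hβ _ (isDensity_prodState fun _ => mixed_density hd), ?_⟩
    rw [Finset.sum_empty, Finset.card_empty, Nat.cast_zero,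
      Real.zero_rpow (by norm_num), mul_zero, add_zero]
    refine le_csInf (set_nonempty hd β _) ?_
    rintro x ⟨ρ, hρ, rfl⟩
    have := div_le_div_of_nonneg_right (entropy_le_mixed hd hρ) hβ.le
    simp only [freeEnergyFun, energy, Matrix.zero_mul, Matrix.trace_zero, Complex.zero_re]
    linarith
  · have hn : 0 < n := by
      obtain ⟨e, he⟩ := Finset.card_pos.mp hE
      have : 0 < e.card := by rw [hk e he]; exact hk0
      obtain ⟨u, -⟩ := Finset.card_pos.mp this
      exact u.pos
    have hn0 : (0 : ℝ) < n := by exact_mod_cast hn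
    have hm0 : (0 : ℝ) < E.card := by exact_mod_cast hE
    have hT : 0 < (n : ℝ) ^ (((k : ℝ) - 1) / 3) * (E.card : ℝ) ^ ((2 : ℝ) / 3) := by positivity
    obtain ⟨x, ⟨ρ, hρ, rfl⟩, hlt⟩ := Real.lt_sInf_add_pos
      (set_nonempty hd β (∑ e ∈ E, h e)) hT
    obtain ⟨σ, hσ, hb⟩ := product_bound hd k hk0 hβ hρ E hE hn hk h hA hA1 K1 K2 D hK1 hK2 hD
    refine ⟨σ, hσ, freeEnergy_le hd hβ _ (isDensity_prodState hσ), ?_⟩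
    change _ < freeEnergy β _ + _ at hlt
    rw [mul_assoc (2 * (K1 + K2) * k + K2 * k * D + 1)]
    linarith

end QLH
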